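/- arXiv:1703.02172 — 4 statements merged into one kernel-verified Lean document; each statement's English description precedes it below -/
import Mathlib

section
/- Let β = (1+√5)/2 be the golden ratio. For every integer N ≥ 3, dim_H(F_{β,N}) = (log λ_N)/(log β), where λ_N is the largest positive real root of the equation x^{N−1} = ∑_{i=0}^{N−3} x^i. -/
open MeasureTheory Set Filter

noncomputable section

/-- The greedy β-transformation. -/
def greedyMap (β : ℝ) (x : ℝ) : ℝ := if x < 1 / β then β * x else β * x - 1

/-- `F_{β,N}`: points whose greedy orbit avoids `[0, β^{-N}/(β-1)]`. -/
def Fset (β : ℝ) (N : ℕ) : Set ℝ :=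
  {x ∈ Icc 0 (1 / (β - 1)) |
    ∀ k : ℕ, (greedyMap β)^[k] x ∉ Icc 0 (β ^ (-(N : ℤ)) / (β - 1))}

/-! ### Coding maps of affine systems -/

def pprod {m : ℕ} (r : Fin m → ℝ) (w : ℕ → Fin m) (n : ℕ) : ℝ :=
  ∏ k ∈ Finset.range n, r (w k)

def code {m : ℕ} (r b : Fin m → ℝ) (w : ℕ → Fin m) : ℝ :=
  ∑' n, pprod r w n * b (w n)

lemma pprod_nonneg {m : ℕ} {r : Fin m → ℝ} (hr : ∀ i, 0 ≤ r i) (w n) : 0 ≤ pprod r w n :=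
  Finset.prod_nonneg fun _ _ => hr _

lemma partial_le {m : ℕ} {r b : Fin m → ℝ} (hr : ∀ i, 0 ≤ r i)
    (h : ∀ i, b i + r i ≤ 1) (w : ℕ → Fin m) (n : ℕ) :
    ∑ k ∈ Finset.range n, pprod r w k * b (w k) + pprod r w n ≤ 1 := by
  induction n with
  | zero => simp [pprod]
  | succ n ih =>
    have e : pprod r w (n+1) = pprod r w n * r (w n) := by simp [pprod, Finset.prod_range_succ]
    rw [Finset.sum_range_succ, e]
    have := mul_le_mul_of_nonneg_left (h (w n)) (pprod_nonneg hr w n)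
    nlinarith

lemma code_summable {m : ℕ} {r b : Fin m → ℝ} (hr : ∀ i, 0 ≤ r i) (hb : ∀ i, 0 ≤ b i)
    (h : ∀ i, b i + r i ≤ 1) (w : ℕ → Fin m) :
    Summable (fun n => pprod r w n * b (w n)) :=
  summable_of_sum_range_le (c := 1) (fun n => mul_nonneg (pprod_nonneg hr w n) (hb _))
    (fun n => by linarith [partial_le hr h w n, pprod_nonneg hr w n])

lemma code_mem {m : ℕ} {r b : Fin m → ℝ} (hr : ∀ i, 0 ≤ r i) (hb : ∀ i, 0 ≤ b i)
    (h : ∀ i, b i + r i ≤ 1) (w : ℕ → Fin m) : code r b w ∈ Icc (0:ℝ) 1 := by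
  constructor
  · exact tsum_nonneg fun n => mul_nonneg (pprod_nonneg hr w n) (hb _)
  · exact Real.tsum_le_of_sum_range_le (fun n => mul_nonneg (pprod_nonneg hr w n) (hb _))
      (fun n => by linarith [partial_le hr h w n, pprod_nonneg hr w n])

lemma code_shift {m : ℕ} {r b : Fin m → ℝ} (hr : ∀ i, 0 ≤ r i) (hb : ∀ i, 0 ≤ b i)
    (h : ∀ i, b i + r i ≤ 1) (w : ℕ → Fin m) :
    code r b w = b (w 0) + r (w 0) * code r b (fun n => w (n+1)) := by
  unfold code
  rw [(code_summable hr hb h w).tsum_eq_zero_add, ← tsum_mul_left]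
  congr 1
  · simp [pprod]
  · congr 1; ext n
    simp only [pprod, Finset.prod_range_succ']
    ring

lemma code_surj {m : ℕ} {r b : Fin m → ℝ} (hr : ∀ i, 0 ≤ r i) (hb : ∀ i, 0 ≤ b i)
    (ρ : ℝ) (hρ : ρ < 1) (hrρ : ∀ i, r i ≤ ρ)
    (hs : ∀ y ∈ Icc (0:ℝ) 1, ∃ i, ∃ z ∈ Icc (0:ℝ) 1, y = b i + r i * z)
    (y : ℝ) (hy : y ∈ Icc (0:ℝ) 1) : ∃ w, code r b w = y := by
  have hs' : ∀ y : Icc (0:ℝ) 1, ∃ i, ∃ z : Icc (0:ℝ) 1, (y:ℝ) = b i + r i * z := by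
    rintro ⟨y, hy⟩
    obtain ⟨i, z, hz, e⟩ := hs y hy
    exact ⟨i, ⟨z, hz⟩, e⟩
  choose I Z hZ using hs'
  let Y : ℕ → Icc (0:ℝ) 1 := fun n => Z^[n] ⟨y, hy⟩
  let w : ℕ → Fin m := fun n => I (Y n)
  have hY : ∀ n, (Y n : ℝ) = b (w n) + r (w n) * Y (n+1) := by
    intro n
    have : Y (n+1) = Z (Y n) := Function.iterate_succ_apply' _ _ _
    rw [this]; exact hZ _
  have hρ0 : 0 ≤ ρ := (hr (w 0)).trans (hrρ _)
  have hP : ∀ n, ∑ k ∈ Finset.range n, pprod r w k * b (w k) = y - pprod r w n * Y n := by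
    intro n
    induction n with
    | zero => simp [pprod, Y]
    | succ n ih =>
      have e : pprod r w (n+1) = pprod r w n * r (w n) := by simp [pprod, Finset.prod_range_succ]
      rw [Finset.sum_range_succ, ih, e, hY n]; ring
  have hle : ∀ n, pprod r w n ≤ ρ ^ n := by
    intro n
    unfold pprod
    calc _ ≤ ∏ k ∈ Finset.range n, ρ := Finset.prod_le_prod (fun _ _ => hr _) (fun _ _ => hrρ _)
      _ = _ := by simp
  refine ⟨w, ?_⟩
  apply HasSum.tsum_eq
  rw [hasSum_iff_tendsto_nat_of_nonneg (fun n => mul_nonneg (pprod_nonneg hr w n) (hb _))]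
  simp_rw [hP]
  have : Tendsto (fun n => pprod r w n * (Y n : ℝ)) atTop (nhds 0) := by
    refine squeeze_zero (fun n => mul_nonneg (pprod_nonneg hr w n) (Y n).2.1) (fun n => ?_)
      (tendsto_pow_atTop_nhds_zero_of_lt_one hρ0 hρ)
    calc _ ≤ pprod r w n * 1 := mul_le_mul_of_nonneg_left (Y n).2.2 (pprod_nonneg hr w n)
      _ ≤ _ := by rw [mul_one]; exact hle n
  simpa using tendsto_const_nhds.sub this

/-- Hölder estimate between two codings. -/
lemma code_holder {m : ℕ} {r b p c : Fin m → ℝ} {s δ : ℝ} (hs : 0 < s) (hδ : 0 < δ)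
    (hr : ∀ i, 0 ≤ r i) (hb : ∀ i, 0 ≤ b i) (h : ∀ i, b i + r i ≤ 1)
    (hc : ∀ i, 0 ≤ c i) (h' : ∀ i, c i + p i ≤ 1) (hp : ∀ i, p i = r i ^ s)
    (hsep : ∀ w v : ℕ → Fin m, w 0 ≠ v 0 → δ ≤ |code r b w - code r b v|)
    (w v : ℕ → Fin m) :
    |code p c w - code p c v| ≤ (δ ^ s)⁻¹ * |code r b w - code r b v| ^ s := by
  have hp0 : ∀ i, 0 ≤ p i := fun i => by rw [hp]; exact Real.rpow_nonneg (hr i) s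
  have key : ∀ n, ∀ w v : ℕ → Fin m, w n ≠ v n →
      |code p c w - code p c v| ≤ (δ ^ s)⁻¹ * |code r b w - code r b v| ^ s := by
    intro n
    have base : ∀ w v : ℕ → Fin m, w 0 ≠ v 0 →
      |code p c w - code p c v| ≤ (δ ^ s)⁻¹ * |code r b w - code r b v| ^ s := by
      intro w v hwv
      have h1 : |code p c w - code p c v| ≤ 1 := by
        have a1 := code_mem hp0 hc h' w
        have a2 := code_mem hp0 hc h' v
        rw [abs_le]; constructor <;> linarith [a1.1, a1.2, a2.1, a2.2]
      have h2 : δ ^ s ≤ |code r b w - code r b v| ^ s :=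
        Real.rpow_le_rpow hδ.le (hsep w v hwv) hs.le
      have h3 : 0 < δ ^ s := Real.rpow_pos_of_pos hδ s
      calc _ ≤ 1 := h1
        _ = (δ ^ s)⁻¹ * δ ^ s := by field_simp
        _ ≤ _ := by gcongr
    induction n with
    | zero => exact base
    | succ n ih =>
      intro w v hwv
      by_cases h0 : w 0 = v 0
      · have := ih (fun n => w (n+1)) (fun n => v (n+1)) hwv
        rw [code_shift hp0 hc h' w, code_shift hp0 hc h' v, code_shift hr hb h w,
          code_shift hr hb h v, h0, add_sub_add_left_eq_sub, add_sub_add_left_eq_sub, ← mul_sub,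
          ← mul_sub, abs_mul, abs_mul, abs_of_nonneg (hp0 _), abs_of_nonneg (hr _),
          Real.mul_rpow (hr _) (abs_nonneg _), ← hp]
        calc _ ≤ _ := mul_le_mul_of_nonneg_left this (hp0 (v 0))
          _ = _ := by ring
      · exact base w v h0
  by_cases hwv : w = v
  · subst hwv
    simp [Real.zero_rpow hs.ne']
  · obtain ⟨n, hn⟩ := Function.ne_iff.1 hwv
    exact key n w v hn

lemma dimH_code_ge {m : ℕ} {r b p c : Fin m → ℝ} {s δ ρ : ℝ} (hs : 0 < s) (hδ : 0 < δ)
    (hr : ∀ i, 0 ≤ r i) (hb : ∀ i, 0 ≤ b i) (h : ∀ i, b i + r i ≤ 1)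
    (hc : ∀ i, 0 ≤ c i) (h' : ∀ i, c i + p i ≤ 1) (hp : ∀ i, p i = r i ^ s)
    (hsep : ∀ w v : ℕ → Fin m, w 0 ≠ v 0 → δ ≤ |code r b w - code r b v|)
    (hρ : ρ < 1) (hpρ : ∀ i, p i ≤ ρ)
    (hsurj : ∀ y ∈ Icc (0:ℝ) 1, ∃ i, ∃ z ∈ Icc (0:ℝ) 1, y = c i + p i * z) :
    ENNReal.ofReal s ≤ dimH (range (code r b)) := by
  classical
  have hp0 : ∀ i, 0 ≤ p i := fun i => by rw [hp]; exact Real.rpow_nonneg (hr i) s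
  have hH := code_holder hs hδ hr hb h hc h' hp hsep
  let f : ℝ → ℝ := fun x => if hx : ∃ w, code r b w = x then code p c hx.choose else 0
  have hf : ∀ w, f (code r b w) = code p c w := by
    intro w
    have hx : ∃ v, code r b v = code r b w := ⟨w, rfl⟩
    have e : f (code r b w) = code p c hx.choose := dif_pos hx
    have := hH hx.choose w
    rw [hx.choose_spec, sub_self, abs_zero, Real.zero_rpow hs.ne', mul_zero] at this
    rw [e]
    exact sub_eq_zero.1 (abs_eq_zero.1 (le_antisymm this (abs_nonneg _)))
  have hδs : 0 < δ ^ s := Real.rpow_pos_of_pos hδ s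
  have hold : HolderOnWith (Real.toNNReal (δ ^ s)⁻¹) (Real.toNNReal s) f (range (code r b)) := by
    rintro _ ⟨w, rfl⟩ _ ⟨v, rfl⟩
    rw [hf, hf, edist_dist, edist_dist, Real.dist_eq, Real.dist_eq, Real.coe_toNNReal s hs.le,
      ENNReal.ofReal_rpow_of_nonneg (abs_nonneg _) hs.le]
    change _ ≤ ENNReal.ofReal _ * _
    rw [← ENNReal.ofReal_mul (by positivity)]
    exact ENNReal.ofReal_le_ofReal (hH w v)
  have h1 := hold.dimH_image_le (by simpa using hs)
  have h2 : Icc (0:ℝ) 1 ⊆ f '' range (code r b) := by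
    intro y hy
    obtain ⟨w, hw⟩ := code_surj hp0 hc ρ hρ hpρ hsurj y hy
    exact ⟨_, ⟨w, rfl⟩, by rw [hf, hw]⟩
  have h3 : dimH (Icc (0:ℝ) 1) = 1 := by
    rw [Real.dimH_of_nonempty_interior (by rw [interior_Icc]; exact ⟨1/2, by norm_num, by norm_num⟩)]
    simp
  have h4 : 1 ≤ dimH (range (code r b)) / ENNReal.ofReal s := by
    rw [← h3]; exact (dimH_mono h2).trans h1
  have h5 := ENNReal.mul_le_of_le_div h4
  simpa using h5

/-! ### Upper bound by covers -/

lemma exists_cover {m : ℕ} {r b : Fin m → ℝ} (hr : ∀ i, 0 ≤ r i) {S : Set ℝ}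
    (hS : S ⊆ Icc 0 1) (hSS : ∀ x ∈ S, ∃ i, ∃ y ∈ S, x = b i + r i * y) (n : ℕ) :
    ∃ t : (Fin n → Fin m) → Set ℝ, S ⊆ ⋃ w, t w ∧
      ∀ w, Metric.ediam (t w) ≤ ENNReal.ofReal (∏ k, r (w k)) := by
  induction n with
  | zero =>
    refine ⟨fun _ => Icc 0 1, fun x hx => mem_iUnion.2 ⟨default, hS hx⟩, fun w => ?_⟩
    simp
  | succ n ih =>
    obtain ⟨t, ht, hd⟩ := ih
    refine ⟨fun w => (fun y => b (w 0) + r (w 0) * y) '' t (Fin.tail w), fun x hx => ?_,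
      fun w => ?_⟩
    · obtain ⟨i, y, hy, rfl⟩ := hSS x hx
      obtain ⟨v, hv⟩ := mem_iUnion.1 (ht hy)
      exact mem_iUnion.2 ⟨Fin.cons i v, y, by simpa using hv, by simp⟩
    · have hl : LipschitzWith (Real.toNNReal (r (w 0))) (fun y => b (w 0) + r (w 0) * y) := by
        apply LipschitzWith.of_dist_le_mul
        intro x y
        rw [Real.dist_eq, Real.dist_eq, add_sub_add_left_eq_sub, ← mul_sub, abs_mul,
          abs_of_nonneg (hr _), Real.coe_toNNReal _ (hr _)]
      refine (hl.ediam_image_le _).trans ?_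
      rw [Fin.prod_univ_succ, ENNReal.ofReal_mul (hr _)]
      exact mul_le_mul_right (hd (Fin.tail w)) _

lemma dimH_le_of_cover {m : ℕ} {r b : Fin m → ℝ} {s ρ : ℝ} (hs : 0 ≤ s) (hr : ∀ i, 0 ≤ r i)
    (hρ0 : 0 ≤ ρ) (hρ : ρ < 1) (hrρ : ∀ i, r i ≤ ρ) (hsum : ∑ i, r i ^ s = 1) {S : Set ℝ}
    (hS : S ⊆ Icc 0 1) (hSS : ∀ x ∈ S, ∃ i, ∃ y ∈ S, x = b i + r i * y) :
    dimH S ≤ ENNReal.ofReal s := by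
  choose t ht hd using exists_cover hr hS hSS
  have hlim : Tendsto (fun n : ℕ => ENNReal.ofReal (ρ ^ n)) atTop (nhds 0) := by
    have := ENNReal.tendsto_ofReal (tendsto_pow_atTop_nhds_zero_of_lt_one hρ0 hρ)
    simpa using this
  have H := Measure.hausdorffMeasure_le_liminf_sum s S _ hlim t
    (Eventually.of_forall fun n w => (hd n w).trans (ENNReal.ofReal_le_ofReal (by
      calc _ ≤ ∏ k : Fin n, ρ := Finset.prod_le_prod (fun _ _ => hr _) (fun _ _ => hrρ _)
        _ = _ := by simp))) (Eventually.of_forall ht)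
  have hle : ∀ n, ∑ w, Metric.ediam (t n w) ^ s ≤ 1 := by
    intro n
    calc _ ≤ ∑ w : Fin n → Fin m, ENNReal.ofReal (∏ k, r (w k) ^ s) := by
          refine Finset.sum_le_sum fun w _ => ?_
          rw [Real.finsetProd_rpow _ _ (fun _ _ => hr _),
            ← ENNReal.ofReal_rpow_of_nonneg (Finset.prod_nonneg fun _ _ => hr _) hs]
          exact ENNReal.rpow_le_rpow (hd n w) hs
      _ = ENNReal.ofReal (∑ w : Fin n → Fin m, ∏ k, r (w k) ^ s) := by
          rw [ENNReal.ofReal_sum_of_nonneg]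
          exact fun _ _ => Finset.prod_nonneg fun _ _ => Real.rpow_nonneg (hr _) _
      _ = 1 := by
          have := (Finset.prod_univ_sum (fun _ : Fin n => (Finset.univ : Finset (Fin m)))
            (fun _ i => r i ^ s)).symm
          rw [Fintype.piFinset_univ] at this
          rw [this]; simp [hsum]
  have H2 : μH[s] S ≤ 1 := H.trans ((liminf_le_liminf (Eventually.of_forall hle)).trans (by simp))
  have := dimH_le_of_hausdorffMeasure_ne_top (d := Real.toNNReal s) (s := S) (by
    rw [Real.coe_toNNReal s hs]; exact (H2.trans_lt (by simp)).ne)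
  exact this

/-! ### The greedy map -/

lemma dimH_preimage_greedy {b : ℝ} (hb : 0 < b) (S : Set ℝ) :
    dimH (greedyMap b ⁻¹' S) ≤ dimH S := by
  have h1 : greedyMap b ⁻¹' S ⊆ (fun y => b⁻¹ * y) '' S ∪ (fun y => b⁻¹ * (y + 1)) '' S := by
    intro x hx
    simp only [mem_preimage, greedyMap] at hx
    split_ifs at hx with h
    · exact Or.inl ⟨_, hx, by field_simp⟩
    · exact Or.inr ⟨_, hx, by field_simp; ring⟩
  refine (dimH_mono h1).trans ?_
  rw [dimH_union]
  have l1 : LipschitzWith (Real.toNNReal b⁻¹) (fun y : ℝ => b⁻¹ * y) := by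
    apply LipschitzWith.of_dist_le_mul
    intro x y
    rw [Real.dist_eq, Real.dist_eq, ← mul_sub, abs_mul, Real.coe_toNNReal _ (by positivity),
      abs_of_pos (inv_pos.2 hb)]
  have l2 : LipschitzWith (Real.toNNReal b⁻¹) (fun y : ℝ => b⁻¹ * (y + 1)) := by
    apply LipschitzWith.of_dist_le_mul
    intro x y
    rw [Real.dist_eq, Real.dist_eq, ← mul_sub, abs_mul, Real.coe_toNNReal _ (by positivity),
      abs_of_pos (inv_pos.2 hb), add_sub_add_right_eq_sub]
  exact max_le (l1.dimH_image_le S) (l2.dimH_image_le S)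

lemma dimH_iterate_preimage {b : ℝ} (hb : 0 < b) (S : Set ℝ) :
    dimH {x | ∃ k, (greedyMap b)^[k] x ∈ S} ≤ dimH S := by
  have : {x | ∃ k, (greedyMap b)^[k] x ∈ S} = ⋃ k, (greedyMap b)^[k] ⁻¹' S := by
    ext; simp
  rw [this, dimH_iUnion]
  refine iSup_le fun k => ?_
  induction k with
  | zero => simp
  | succ k ih =>
    rw [Function.iterate_succ, preimage_comp]
    exact (dimH_preimage_greedy hb _).trans ih

lemma greedy_lt {b q : ℝ} (hbq : b * q = 1) (hq : q = b - 1) (h1 : 1 < b)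
    {x : ℝ} (hx : x < q) : greedyMap b x = b * x := by
  have : 1 / b = q := by field_simp; linarith
  rw [greedyMap, if_pos (by rw [this]; exact hx)]

lemma greedy_ge {b q : ℝ} (hbq : b * q = 1) (hq : q = b - 1) (h1 : 1 < b)
    {x : ℝ} (hx : q ≤ x) : greedyMap b x = b * x - 1 := by
  have : 1 / b = q := by field_simp; linarith
  rw [greedyMap, if_neg (by rw [this]; exact not_lt.2 hx)]

lemma mem_Fset {b q : ℝ} (hbq : b * q = 1) (hq : q = b - 1) (h1 : 1 < b)
    {n : ℕ} {x : ℝ} : x ∈ Fset b (n+2) ↔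
    x ∈ Icc 0 b ∧ ∀ k, (greedyMap b)^[k] x ∉ Icc 0 (q ^ (n+1)) := by
  have e0 : b = q⁻¹ := eq_inv_of_mul_eq_one_left hbq
  have q0 : q ≠ 0 := by rintro rfl; simp at hbq
  have e1 : 1 / (b - 1) = b := by rw [← hq, e0]; simp
  have e2 : b ^ (-((n+2 : ℕ) : ℤ)) / (b - 1) = q ^ (n+1) := by
    rw [← hq, zpow_neg, zpow_natCast, e0, inv_pow, inv_inv, pow_succ q (n+1)]
    field_simp
  unfold Fset
  rw [mem_ofPred_eq, e1, e2]

lemma Fset_greedy {b q : ℝ} (hbq : b * q = 1) (hq : q = b - 1) (h1 : 1 < b)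
    {n : ℕ} {x : ℝ} (hx : x ∈ Fset b (n+2)) : greedyMap b x ∈ Fset b (n+2) := by
  rw [mem_Fset hbq hq h1] at hx ⊢
  obtain ⟨⟨h0, hb⟩, hk⟩ := hx
  refine ⟨?_, fun k => ?_⟩
  · rcases lt_or_ge x q with h | h
    · rw [greedy_lt hbq hq h1 h]
      constructor <;> nlinarith
    · rw [greedy_ge hbq hq h1 h]
      constructor <;> nlinarith
  · rw [← Function.iterate_succ_apply]; exact hk _

/-- first part: reach `[q,1)`. -/
lemma reach {b q : ℝ} (hbq : b * q = 1) (hq : q = b - 1) (h1 : 1 < b)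
    {n : ℕ} (i : ℕ) : ∀ y ∈ Fset b (n+2), y < 1 → q ^ (i+1) ≤ y →
    ∃ j ≤ i, ∃ z ∈ Fset b (n+2) ∩ Ico q 1, y = q ^ j * z ∧ (greedyMap b)^[j] y = z := by
  induction i with
  | zero =>
    intro y hy hy1 hyq
    exact ⟨0, le_rfl, y, ⟨hy, by simpa using hyq, hy1⟩, by simp, rfl⟩
  | succ i ih =>
    intro y hy hy1 hyq
    rcases lt_or_ge y q with h | h
    · have hG := Fset_greedy hbq hq h1 hy
      have e := greedy_lt hbq hq h1 h
      obtain ⟨j, hj, z, hz, hz1, hz2⟩ := ih (greedyMap b y) hG (by rw [e]; nlinarith) (by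
        rw [e]
        calc q ^ (i+1) = b * q ^ (i+1+1) := by rw [pow_succ q (i+1)]; linear_combination (-q^(i+1))*hbq
          _ ≤ _ := by gcongr)
      refine ⟨j+1, by omega, z, hz, ?_, by rw [Function.iterate_succ_apply]; exact hz2⟩
      rw [e] at hz1
      rw [pow_succ]
      linear_combination q * hz1 - y * hbq
    · exact ⟨0, by omega, y, ⟨hy, h, hy1⟩, by simp, rfl⟩

lemma reach' {b q : ℝ} (hbq : b * q = 1) (hq : q = b - 1) (h1 : 1 < b)
    {n : ℕ} (hn : 1 ≤ n) {y : ℝ} (hy : y ∈ Fset b (n+2)) (hy1 : y < 1) :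
    ∃ j ≤ n, ∃ z ∈ Fset b (n+2) ∩ Ico q 1, y = q ^ j * z ∧ (greedyMap b)^[j] y = z := by
  refine reach hbq hq h1 n y hy hy1 ?_
  have := (mem_Fset hbq hq h1).1 hy
  have h2 := this.2 0
  simp only [Function.iterate_zero, id, mem_Icc, not_and, not_le] at h2
  exact (h2 this.1.1).le

lemma F1_self {b q : ℝ} (hbq : b * q = 1) (hq : q = b - 1) (h1 : 1 < b)
    {n : ℕ} (hn : 1 ≤ n) : ∀ x ∈ Fset b (n+2) ∩ Ico q 1,
    ∃ i : Fin n, ∃ z ∈ Fset b (n+2) ∩ Ico q 1, x = q + q ^ ((i:ℕ)+2) * z := by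
  rintro x ⟨hx, hxq, hx1⟩
  have e := greedy_ge hbq hq h1 hxq
  have hyq : greedyMap b x < q := by rw [e]; nlinarith
  obtain ⟨j, hj, z, hz, hz1, hz2⟩ := reach' hbq hq h1 hn (Fset_greedy hbq hq h1 hx) (by
    nlinarith)
  cases j with
  | zero =>
    simp at hz1
    exact absurd hz.2.1 (by rw [← hz1]; exact not_le.2 hyq)
  | succ j =>
    refine ⟨⟨j, by omega⟩, z, hz, ?_⟩
    rw [e] at hz1
    simp only [pow_succ] at hz1 ⊢
    linear_combination q * hz1 - x * hbq

lemma F_sub {b q : ℝ} (hbq : b * q = 1) (hq : q = b - 1) (h1 : 1 < b)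
    {n : ℕ} (hn : 1 ≤ n) : Fset b (n+2) ⊆
    {b} ∪ {x | ∃ k, (greedyMap b)^[k] x ∈ Fset b (n+2) ∩ Ico q 1} := by
  intro x hx
  by_cases hxb : x = b
  · exact Or.inl hxb
  right
  have hxb' : x < b := lt_of_le_of_ne ((mem_Fset hbq hq h1).1 hx).1.2 hxb
  have hF : ∀ k, (greedyMap b)^[k] x ∈ Fset b (n+2) := by
    intro k
    induction k with
    | zero => exact hx
    | succ k ih => rw [Function.iterate_succ_apply']; exact Fset_greedy hbq hq h1 ih
  have hex : ∃ k, (greedyMap b)^[k] x < 1 := by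
    by_contra! hcon
    have hk : ∀ k, b - (greedyMap b)^[k] x = b ^ k * (b - x) := by
      intro k
      induction k with
      | zero => simp
      | succ k ih =>
        rw [Function.iterate_succ_apply', greedy_ge hbq hq h1 (by nlinarith [hcon k]), pow_succ]
        subst hq
        linear_combination b * ih - hbq
    obtain ⟨k, hk'⟩ := pow_unbounded_of_one_lt (b / (b - x)) h1
    rw [div_lt_iff₀ (by linarith)] at hk'
    linarith [hk k, hcon k]
  obtain ⟨k, hk⟩ := hex
  obtain ⟨j, hj, z, hz, hz1, hz2⟩ := reach' hbq hq h1 hn (hF k) hk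
  refine ⟨j + k, ?_⟩
  rw [Function.iterate_add_apply, hz2]; exact hz

/-- Points of the symbolic set either eventually hit `0` or lie in `F`. -/
lemma E_sub {b q : ℝ} (hbq : b * q = 1) (hq : q = b - 1) (h1 : 1 < b)
    {n : ℕ} {E : Set ℝ} (hE : ∀ x ∈ E, q < x ∧ x ≤ 1)
    (hEE : ∀ x ∈ E, ∃ i : Fin n, ∃ z ∈ E, x = q + q ^ ((i:ℕ)+2) * z) :
    E ⊆ Fset b (n+2) ∪ {x | ∃ k, (greedyMap b)^[k] x ∈ ({0} : Set ℝ)} := by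
  intro x hx
  by_cases h0 : ∃ k, (greedyMap b)^[k] x ∈ ({0} : Set ℝ)
  · exact Or.inr h0
  left
  have q0 : 0 < q := by linarith
  have q1 : q < 1 := by nlinarith
  have h0' : ∀ k, (greedyMap b)^[k] x ≠ 0 := fun k hk => h0 ⟨k, hk⟩
  have hV : ∀ k, ∃ i ≤ n, ∃ z ∈ E, (greedyMap b)^[k] x = q ^ i * z := by
    intro k
    induction k with
    | zero => exact ⟨0, by omega, x, hx, by simp⟩
    | succ k ih =>
      obtain ⟨i, hi, z, hz, e⟩ := ih
      have h3 := h0' (k+1)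
      rw [Function.iterate_succ_apply'] at h3 ⊢
      rw [e] at h3 ⊢
      cases i with
      | zero =>
        rw [pow_zero, one_mul] at *
        obtain ⟨i, z', hz', e'⟩ := hEE z hz
        refine ⟨i + 1, by omega, z', hz', ?_⟩
        rw [greedy_ge hbq hq h1 (hE z hz).1.le, e']
        simp only [pow_succ]
        linear_combination (1 + q ^ (i:ℕ) * q * z') * hbq
      | succ i =>
        have hle : q ^ (i+1) * z ≤ q := by
          have a1 : q ^ (i+1) ≤ q := by
            rw [pow_succ]; exact mul_le_of_le_one_left q0.le (pow_le_one₀ q0.le q1.le)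
          calc _ ≤ q ^ (i+1) * 1 := by gcongr; exact (hE z hz).2
            _ ≤ q := by linarith
        rcases lt_or_eq_of_le hle with h | h
        · refine ⟨i, by omega, z, hz, ?_⟩
          rw [greedy_lt hbq hq h1 h, pow_succ]
          linear_combination q ^ i * z * hbq
        · exfalso; apply h3
          rw [h, greedy_ge hbq hq h1 le_rfl, hbq, sub_self]
  rw [mem_Fset hbq hq h1]
  refine ⟨⟨by linarith [(hE x hx).1], by linarith [(hE x hx).2]⟩, fun k hk => ?_⟩
  obtain ⟨i, hi, z, hz, e⟩ := hV k
  have a1 : q ^ (n+1) ≤ q ^ (i+1) := pow_le_pow_of_le_one q0.le q1.le (by omega)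
  have a2 : q ^ (i+1) < q ^ i * z := by
    rw [pow_succ]; exact mul_lt_mul_of_pos_left (hE z hz).1 (by positivity)
  linarith [hk.2]

lemma exists_slot (p : ℕ → ℝ) (m : ℕ) (y : ℝ) (hy : 0 ≤ y) (hm : 1 ≤ m)
    (h : y ≤ ∑ k ∈ Finset.range m, p k) :
    ∃ i < m, ∑ k ∈ Finset.range i, p k ≤ y ∧ y ≤ ∑ k ∈ Finset.range i, p k + p i := by
  induction m with
  | zero => omega
  | succ m ih =>
    rcases le_or_gt (∑ k ∈ Finset.range m, p k) y with h2 | h2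
    · exact ⟨m, by omega, h2, by rwa [Finset.sum_range_succ] at h⟩
    · have hm1 : 1 ≤ m := by
        rcases Nat.eq_zero_or_pos m with rfl | h3
        · simp at h2; linarith
        · exact h3
      obtain ⟨i, hi, h4⟩ := ih hm1 h2.le
      exact ⟨i, by omega, h4⟩

lemma main_aux {b q : ℝ} (hbq : b * q = 1) (hq : q = b - 1) (h1 : 1 < b) {n : ℕ} (hn : 1 ≤ n)
    {lam : ℝ} (hl0 : 0 < lam) (hl : lam ^ (n+1) = ∑ i ∈ Finset.range n, lam ^ i) :
    dimH (Fset b (n+2)) = ENNReal.ofReal (Real.log lam / Real.log b) := by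
  have q0 : 0 < q := by linarith
  have q1 : q < 1 := by nlinarith
  have hqq : q + q ^ 2 = 1 := by rw [sq]; nlinarith
  set s := Real.log lam / Real.log b with hsdef
  have hlogb : 0 < Real.log b := Real.log_pos h1
  have hl1 : 1 ≤ lam := by
    by_contra! hlt
    have h2 : lam ^ (n+1) < 1 := pow_lt_one₀ hl0.le hlt (by omega)
    have h3 : lam ^ 0 ≤ ∑ i ∈ Finset.range n, lam ^ i :=
      Finset.single_le_sum (f := fun i => lam ^ i) (fun i _ => by positivity)
        (Finset.mem_range.2 (by omega))
    simp at h3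
    linarith
  have hs : 0 ≤ s := div_nonneg (Real.log_nonneg hl1) hlogb.le
  have hqs : q ^ s = lam⁻¹ := by
    have e : q = b⁻¹ := eq_inv_of_mul_eq_one_right hbq
    rw [Real.rpow_def_of_pos q0, e, Real.log_inv, hsdef]
    rw [show -Real.log b * (Real.log lam / Real.log b) = - Real.log lam by field_simp,
      Real.exp_neg, Real.exp_log hl0]
  have hrs : ∀ k : ℕ, (q ^ k) ^ s = (lam⁻¹) ^ k := by
    intro k
    rw [← hqs, ← Real.rpow_natCast, ← Real.rpow_mul q0.le, mul_comm, Real.rpow_mul q0.le,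
      Real.rpow_natCast]
  have hsum : ∑ i ∈ Finset.range n, (lam⁻¹) ^ (i+2) = 1 := by
    rw [← Finset.sum_range_reflect]
    have : ∀ i ∈ Finset.range n, (lam⁻¹) ^ (n - 1 - i + 2) = (lam ^ (n+1))⁻¹ * lam ^ i := by
      intro i hi
      have hi := Finset.mem_range.1 hi
      have e : n + 1 = (n - 1 - i + 2) + i := by omega
      rw [e, pow_add lam, inv_pow]
      field_simp
      
    rw [Finset.sum_congr rfl this, ← Finset.mul_sum, ← hl]
    field_simp
  let r : Fin n → ℝ := fun i => q ^ ((i:ℕ)+2)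
  have hr : ∀ i, 0 ≤ r i := fun i => by positivity
  have hrq : ∀ i, r i ≤ q ^ 2 := fun i => pow_le_pow_of_le_one q0.le q1.le (by omega)
  apply le_antisymm
  · refine (dimH_mono (F_sub hbq hq h1 hn)).trans ?_
    rw [dimH_union, dimH_singleton]
    refine max_le (by simp) ((dimH_iterate_preimage (by linarith) _).trans ?_)
    refine dimH_le_of_cover (r := r) (b := fun _ => q) (ρ := q ^ 2) hs hr (by positivity)
      (by linarith) hrq ?_ (fun x hx => ⟨by linarith [hx.2.1], hx.2.2.le⟩) (F1_self hbq hq h1 hn)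
    rw [← hsum, Finset.sum_range]
    exact Finset.sum_congr rfl fun i _ => hrs _
  · rcases hs.eq_or_lt with h0 | hs0
    · rw [← h0]; simp
    have hlam1 : 1 < lam := by
      rcases hl1.eq_or_lt with h | h
      · rw [hsdef, ← h] at hs0; simp at hs0
      · exact h
    have li0 : 0 < lam⁻¹ := by positivity
    have li1 : lam⁻¹ < 1 := inv_lt_one_of_one_lt₀ hlam1
    let bb : Fin n → ℝ := fun _ => q
    have hbb : ∀ i, 0 ≤ bb i := fun _ => q0.le
    have hbr : ∀ i, bb i + r i ≤ 1 := fun i => by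
      have := hrq i
      change q + r i ≤ 1
      linarith
    have hmem := code_mem hr hbb hbr
    have hsh := code_shift hr hbb hbr
    have hge : ∀ w, q ≤ code r bb w := by
      intro w
      rw [hsh w]
      have := mul_nonneg (hr (w 0)) (hmem (fun n => w (n+1))).1
      change q ≤ q + _
      linarith
    have hge2 : ∀ w, q + q ^ (n+1) * q ≤ code r bb w := by
      intro w
      rw [hsh w]
      change _ ≤ q + _
      have a1 : q ^ (n+1) ≤ r (w 0) := pow_le_pow_of_le_one q0.le q1.le (by omega)
      have a2 := hge (fun n => w (n+1))
      have : q ^ (n+1) * q ≤ r (w 0) * code r bb (fun n => w (n+1)) := by gcongr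
      linarith
    have hsep1 : ∀ w v : ℕ → Fin n, w 0 < v 0 →
        q ^ (n+1) * (q ^ (n+1) * q) ≤ code r bb w - code r bb v := by
      intro w v hwv
      rw [hsh w, hsh v]
      change _ ≤ q + _ - (q + _)
      have a1 : q ^ (n+1) ≤ r (w 0) := pow_le_pow_of_le_one q0.le q1.le (by omega)
      have a2 : r (v 0) ≤ r (w 0) * q := by
        change q ^ _ ≤ q ^ _ * q
        rw [← pow_succ]
        exact pow_le_pow_of_le_one q0.le q1.le (by have : (w 0 : ℕ) < v 0 := hwv; omega)
      have a3 := hge2 (fun n => w (n+1))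
      have a4 := (hmem (fun n => v (n+1))).2
      have a5 : r (w 0) * (q + q ^ (n+1) * q) ≤ r (w 0) * code r bb (fun n => w (n+1)) :=
        mul_le_mul_of_nonneg_left a3 (hr _)
      have a6 : r (v 0) * code r bb (fun n => v (n+1)) ≤ r (v 0) * 1 :=
        mul_le_mul_of_nonneg_left a4 (hr _)
      have a7 : q ^ (n+1) * (q ^ (n+1) * q) ≤ r (w 0) * (q ^ (n+1) * q) := by gcongr
      linarith
    have hsep : ∀ w v : ℕ → Fin n, w 0 ≠ v 0 →
        q ^ (n+1) * (q ^ (n+1) * q) ≤ |code r bb w - code r bb v| := by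
      intro w v hwv
      rcases lt_or_gt_of_ne hwv with h | h
      · exact (hsep1 w v h).trans (le_abs_self _)
      · rw [abs_sub_comm]; exact (hsep1 v w h).trans (le_abs_self _)
    let p : ℕ → ℝ := fun i => (lam⁻¹) ^ (i+2)
    have hp0 : ∀ i, 0 < p i := fun i => by positivity
    have key : ENNReal.ofReal s ≤ dimH (range (code r bb)) := by
      refine dimH_code_ge (p := fun i : Fin n => p i)
        (c := fun i : Fin n => ∑ k ∈ Finset.range i, p k) (ρ := lam⁻¹)
        (δ := q ^ (n+1) * (q ^ (n+1) * q)) hs0 (by positivity) hr hbb hbr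
        (fun i => Finset.sum_nonneg fun k _ => (hp0 k).le) ?_ (fun i => (hrs _).symm) hsep li1 ?_ ?_
      · intro i
        rw [← Finset.sum_range_succ, ← hsum]
        exact Finset.sum_le_sum_of_subset_of_nonneg
          (Finset.range_subset_range.2 (by omega)) (fun k _ _ => (hp0 k).le)
      · intro i
        change lam⁻¹ ^ _ ≤ _
        exact pow_le_of_le_one li0.le li1.le (by omega)
      · intro y hy
        obtain ⟨i, hi, h2, h3⟩ := exists_slot p n y hy.1 hn (by
          change y ≤ ∑ i ∈ Finset.range n, (lam⁻¹) ^ (i+2)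
          rw [hsum]; exact hy.2)
        have := hp0 i
        refine ⟨⟨i, hi⟩, (y - ∑ k ∈ Finset.range i, p k) / p i,
          ⟨div_nonneg (by linarith) this.le, ?_⟩, ?_⟩
        · rw [div_le_one this]; linarith
        · simp only; field_simp; ring
    refine key.trans ?_
    have hE := E_sub (n := n) hbq hq h1 (E := range (code r bb)) (by
      rintro _ ⟨w, rfl⟩
      refine ⟨?_, (hmem w).2⟩
      have : 0 < q ^ (n+1) * q := by positivity
      linarith [hge2 w]) (by
      rintro _ ⟨w, rfl⟩
      exact ⟨w 0, _, ⟨fun n => w (n+1), rfl⟩, hsh w⟩)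
    refine (dimH_mono hE).trans ?_
    rw [dimH_union]
    refine max_le le_rfl ((dimH_iterate_preimage (by linarith) _).trans ?_)
    rw [dimH_singleton]; exact zero_le

theorem dimH_Fset_golden (N : ℕ) (hN : 3 ≤ N) (lam : ℝ)
    (hlam : IsGreatest
      {x : ℝ | 0 < x ∧ x ^ (N - 1) = ∑ i ∈ Finset.range (N - 2), x ^ i} lam) :
    dimH (Fset ((1 + Real.sqrt 5) / 2) N) =
      ENNReal.ofReal (Real.log lam / Real.log ((1 + Real.sqrt 5) / 2)) := by
  obtain ⟨n, rfl⟩ : ∃ n, N = n + 2 := ⟨N - 2, by omega⟩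
  have h5 : Real.sqrt 5 * Real.sqrt 5 = 5 := Real.mul_self_sqrt (by norm_num)
  have h51 : 1 < Real.sqrt 5 := by
    rw [Real.lt_sqrt] <;> norm_num
  obtain ⟨⟨h0, h1⟩, -⟩ := hlam
  exact main_aux (q := (1 + Real.sqrt 5) / 2 - 1) (by linear_combination h5 / 4) rfl (by linarith)
    (by omega) h0 h1
end
end

section
/- For each integer N ≥ 4, let λ_N be the largest positive real root of the equation x^{N−1} = ∑_{i=0}^{N−3} x^i. Then λ_N → (1+√5)/2 as N → ∞. -/
open MeasureTheory Set Filter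

noncomputable section

/-- Multiplying the equation by `x - 1`. -/
lemma root_key (x : ℝ) (n : ℕ) :
    (x ^ (n + 1) - ∑ i ∈ Finset.range n, x ^ i) * (x - 1) = x ^ n * (x ^ 2 - x - 1) + 1 := by
  have h := geom_sum_mul x n
  rw [sub_mul, h]
  ring

/-- If, for each `N ≥ 4`, `λ_N` is the largest positive real root of
`x^{N-1} = ∑_{i=0}^{N-3} x^i`, then `λ_N → (1+√5)/2` as `N → ∞`. -/
theorem tendsto_largest_root_golden (lam : ℕ → ℝ)
    (hlam : ∀ N : ℕ, 4 ≤ N → IsGreatest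
      {x : ℝ | 0 < x ∧ x ^ (N - 1) = ∑ i ∈ Finset.range (N - 2), x ^ i} (lam N)) :
    Tendsto lam atTop (nhds ((1 + Real.sqrt 5) / 2)) := by
  have h5 : Real.sqrt 5 ^ 2 = 5 := Real.sq_sqrt (by norm_num)
  have h5' : 2 < Real.sqrt 5 := by
    rw [Real.lt_sqrt] <;> norm_num
  rw [tendsto_order]
  constructor
  · intro a' ha'
    obtain ⟨a, ha, haφ⟩ := exists_between
      (max_lt ha' (by linarith : (1 : ℝ) < (1 + Real.sqrt 5) / 2))
    have ha1 : 1 < a := lt_of_le_of_lt (le_max_right _ _) ha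
    have haa : a' < a := lt_of_le_of_lt (le_max_left _ _) ha
    have hneg : 0 < -(a ^ 2 - a - 1) := by nlinarith
    have ht : Tendsto (fun n : ℕ => a ^ n * (-(a ^ 2 - a - 1))) atTop atTop :=
      (tendsto_pow_atTop_atTop_of_one_lt ha1).atTop_mul_const hneg
    have ht2 := (tendsto_sub_atTop_nat 2).eventually (ht.eventually_gt_atTop 1)
    filter_upwards [ht2, eventually_ge_atTop 4] with N hN hN4
    have hg := hlam N hN4
    obtain ⟨n, rfl⟩ : ∃ n, N = n + 2 := ⟨N - 2, by omega⟩
    simp only [Nat.add_sub_cancel, show n + 2 - 1 = n + 1 by omega] at hN hg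
    have hcont : ContinuousOn (fun x : ℝ => x ^ (n + 1) - ∑ i ∈ Finset.range n, x ^ i)
        (Icc a 2) := by fun_prop
    have ha2 : a ≤ 2 := by nlinarith
    have hfa : a ^ (n + 1) - ∑ i ∈ Finset.range n, a ^ i ≤ 0 := by
      have := root_key a n
      by_contra! hc
      have := mul_pos hc (sub_pos.2 ha1)
      linarith
    have hf2 : (0 : ℝ) ≤ 2 ^ (n + 1) - ∑ i ∈ Finset.range n, 2 ^ i := by
      have := root_key 2 n
      have h2 : (0 : ℝ) < 2 ^ n := by positivity
      linarith
    obtain ⟨x, hx, hx0⟩ := intermediate_value_Icc ha2 hcont ⟨hfa, hf2⟩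
    have := hg.2 ⟨by linarith [hx.1], sub_eq_zero.1 hx0⟩
    linarith [hx.1]
  · intro b hb
    filter_upwards [eventually_ge_atTop 4] with N hN4
    obtain ⟨hpos, he⟩ := (hlam N hN4).1
    obtain ⟨n, rfl⟩ : ∃ n, N = n + 2 := ⟨N - 2, by omega⟩
    simp only [Nat.add_sub_cancel, show n + 2 - 1 = n + 1 by omega] at he
    have hk := root_key (lam (n + 2)) n
    rw [sub_eq_zero.2 he, zero_mul] at hk
    refine lt_trans ?_ hb
    by_contra! hc
    have h1 : 0 ≤ lam (n + 2) ^ 2 - lam (n + 2) - 1 := by nlinarith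
    have := mul_nonneg (pow_pos hpos n).le h1
    linarith
end
end

section
/- For every integer N ≥ 2, dim_H(D_{2^{−N}}) = (log γ_N)/(log 2), where γ_N is the unique root in (1,2) of the equation x^N = x^{N−1} + x^{N−2} + ⋯ + x + 1 (the N-bonacci number). -/
open MeasureTheory Set Filter

noncomputable section

/-- The doubling map `x ↦ 2x mod 1` on `[0,1)`. -/
def doublingMap (x : ℝ) : ℝ := Int.fract (2 * x)

/-- The survivor set of the doubling map with hole `[0, ε]`. -/
def survivorSet (ε : ℝ) : Set ℝ :=
  {x ∈ Ico (0 : ℝ) 1 | ∀ k : ℕ, doublingMap^[k] x ∉ Icc 0 ε}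

/-- Digit series along an orbit. -/
def digSum (b : ℝ) (e T : ℝ → ℝ) (x : ℝ) : ℝ := ∑' k : ℕ, e (T^[k] x) * b⁻¹ ^ (k + 1)

lemma digSum_summable {b : ℝ} (hb : 1 < b) {e T : ℝ → ℝ} (he : ∀ x, 0 ≤ e x ∧ e x ≤ 1) (x : ℝ) :
    Summable (fun k : ℕ => e (T^[k] x) * b⁻¹ ^ (k + 1)) := by
  have hb0 : 0 < b⁻¹ := by positivity
  have h1 : b⁻¹ < 1 := inv_lt_one_of_one_lt₀ hb
  have hg : Summable (fun k : ℕ => b⁻¹ ^ (k + 1)) :=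
    (summable_nat_add_iff 1).2 (summable_geometric_of_lt_one hb0.le h1)
  refine Summable.of_nonneg_of_le (fun k => mul_nonneg (he _).1 (by positivity)) (fun k => ?_) hg
  exact mul_le_of_le_one_left (by positivity) (he _).2

lemma digSum_step {b : ℝ} (hb : 1 < b) {e T : ℝ → ℝ} (he : ∀ x, 0 ≤ e x ∧ e x ≤ 1) (x : ℝ) :
    digSum b e T x = (e x + digSum b e T (T x)) / b := by
  unfold digSum
  rw [(digSum_summable hb he x).tsum_eq_zero_add]
  simp only [Function.iterate_succ, Function.comp, Function.iterate_zero, id]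
  have : ∀ k : ℕ, e (T^[k] (T x)) * b⁻¹ ^ (k + 1 + 1) = (e (T^[k] (T x)) * b⁻¹ ^ (k + 1)) * b⁻¹ := by
    intro k; ring
  simp_rw [this]
  rw [tsum_mul_right]
  ring

lemma digSum_nonneg {b : ℝ} (hb : 1 < b) {e T : ℝ → ℝ} (he : ∀ x, 0 ≤ e x ∧ e x ≤ 1) (x : ℝ) :
    0 ≤ digSum b e T x :=
  tsum_nonneg fun k => mul_nonneg (he _).1 (by positivity)

lemma digSum_le {b : ℝ} (hb : 1 < b) {e T : ℝ → ℝ} (he : ∀ x, 0 ≤ e x ∧ e x ≤ 1) (x : ℝ) :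
    digSum b e T x ≤ 1 / (b - 1) := by
  have hb0 : 0 < b⁻¹ := by positivity
  have h1 : b⁻¹ < 1 := inv_lt_one_of_one_lt₀ hb
  have hg : HasSum (fun k : ℕ => b⁻¹ ^ (k + 1)) (1 / (b - 1)) := by
    have := (hasSum_geometric_of_lt_one hb0.le h1).mul_right b⁻¹
    convert! this using 1
    have : b - 1 ≠ 0 := by linarith
    have h3 : 1 - b⁻¹ ≠ 0 := by linarith
    field_simp
  rw [← hg.tsum_eq]
  exact (digSum_summable hb he x).tsum_le_tsum
    (fun k => mul_le_of_le_one_left (by positivity) (he _).2) hg.summable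

/-- Flipped binary digit. -/
def fdig (x : ℝ) : ℝ := if x < 1 / 2 then 1 else 0

lemma fdig_bd (x : ℝ) : 0 ≤ fdig x ∧ fdig x ≤ 1 := by
  unfold fdig; split_ifs <;> norm_num

lemma doublingMap_lo {x : ℝ} (h0 : 0 ≤ x) (h : x < 1 / 2) : doublingMap x = 2 * x := by
  unfold doublingMap
  exact Int.fract_eq_self.2 ⟨by linarith, by linarith⟩

lemma doublingMap_hi {x : ℝ} (h0 : 1 / 2 ≤ x) (h : x < 1) : doublingMap x = 2 * x - 1 := by
  unfold doublingMap
  rw [← Int.fract_sub_one]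
  exact Int.fract_eq_self.2 ⟨by linarith, by linarith⟩

lemma survivor_map {ε x : ℝ} (h : x ∈ survivorSet ε) : doublingMap x ∈ survivorSet ε := by
  refine ⟨⟨Int.fract_nonneg _, Int.fract_lt_one _⟩, fun k => ?_⟩
  exact h.2 (k + 1)

lemma survivor_gt {ε x : ℝ} (h : x ∈ survivorSet ε) : ε < x := by
  have := h.2 0
  by_contra hc
  exact this ⟨h.1.1, not_lt.1 hc⟩

/-- The quasi-greedy digit. -/
def qdig (γ y : ℝ) : ℝ := if γ * y ≤ 1 then 0 else 1

/-- The quasi-greedy map. -/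
def qmap (γ y : ℝ) : ℝ := γ * y - qdig γ y

lemma qdig_bd (γ x : ℝ) : 0 ≤ qdig γ x ∧ qdig γ x ≤ 1 := by
  unfold qdig; split_ifs <;> norm_num

lemma qdig_or (γ x : ℝ) : qdig γ x = 0 ∨ qdig γ x = 1 := by
  unfold qdig; split_ifs <;> simp

lemma qmap_mem {γ y : ℝ} (hγ : γ ∈ Ioo (1 : ℝ) 2) (hy : y ∈ Ioc (0 : ℝ) 1) :
    qmap γ y ∈ Ioc (0 : ℝ) 1 := by
  obtain ⟨h1, h2⟩ := hγ
  obtain ⟨h3, h4⟩ := hy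
  unfold qmap qdig
  split_ifs with h
  · exact ⟨by simp; positivity, by simpa using h⟩
  · exact ⟨by linarith, by nlinarith⟩

lemma qmap_iter_mem {γ : ℝ} (hγ : γ ∈ Ioo (1 : ℝ) 2) (n : ℕ) :
    ∀ y ∈ Ioc (0 : ℝ) 1, (qmap γ)^[n] y ∈ Ioc (0 : ℝ) 1 := by
  induction n with
  | zero => intro y hy; exact hy
  | succ n ih => intro y hy; exact ih _ (qmap_mem hγ hy)

/-- The binary value of the quasi-greedy digits. -/
def qE (γ y : ℝ) : ℝ := digSum 2 (qdig γ) (qmap γ) y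

lemma qE_step (γ y : ℝ) : qE γ y = (qdig γ y + qE γ (qmap γ y)) / 2 :=
  digSum_step (by norm_num) (qdig_bd γ) y

lemma qE_nonneg (γ y : ℝ) : 0 ≤ qE γ y := digSum_nonneg (by norm_num) (qdig_bd γ) y

lemma qE_le (γ y : ℝ) : qE γ y ≤ 1 := by
  have := digSum_le (b := 2) (T := qmap γ) (by norm_num) (qdig_bd γ) y
  unfold qE
  linarith

lemma qE_pos {γ y : ℝ} (hγ : γ ∈ Ioo (1 : ℝ) 2) (hy : y ∈ Ioc (0 : ℝ) 1) : 0 < qE γ y := by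
  by_contra hc
  have h0 : qE γ y = 0 := le_antisymm (not_lt.1 hc) (qE_nonneg _ _)
  have key : ∀ n : ℕ, ∀ y, qE γ y = 0 → (qmap γ)^[n] y = γ ^ n * y := by
    intro n
    induction n with
    | zero => intro y _; simp
    | succ n ih =>
      intro y h
      have hs := qE_step γ y
      have h1 := qE_nonneg γ (qmap γ y)
      have h2 := (qdig_bd γ y).1
      have h3 : qdig γ y = 0 := by linarith
      have h4 : qE γ (qmap γ y) = 0 := by linarith
      rw [Function.iterate_succ_apply, ih _ h4]
      unfold qmap
      rw [h3]; ring
  obtain ⟨n, hn⟩ := pow_unbounded_of_one_lt (1 / y) hγ.1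
  have h1 := (qmap_iter_mem hγ n y hy).2
  rw [key n y h0] at h1
  rw [div_lt_iff₀ hy.1] at hn
  linarith

lemma qsum_contra {N : ℕ} {γ y : ℝ} (hγ : γ ∈ Ioo (1 : ℝ) 2)
    (hroot : γ ^ N = ∑ i ∈ Finset.range N, γ ^ i) (hy : y ∈ Ioc (0 : ℝ) 1)
    (h : (qmap γ)^[N] y = γ ^ N * y - ∑ i ∈ Finset.range N, γ ^ i) : False := by
  have h1 := (qmap_iter_mem hγ N y hy).1
  rw [h, ← hroot] at h1
  have : 0 < γ ^ N := pow_pos (by linarith [hγ.1]) _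
  nlinarith [hy.2]

lemma qE_lt_one {N : ℕ} {γ y : ℝ} (hγ : γ ∈ Ioo (1 : ℝ) 2)
    (hroot : γ ^ N = ∑ i ∈ Finset.range N, γ ^ i) (hy : y ∈ Ioc (0 : ℝ) 1) : qE γ y < 1 := by
  by_contra hc
  have h0 : qE γ y = 1 := le_antisymm (qE_le _ _) (not_lt.1 hc)
  have key : ∀ n : ℕ, ∀ y, qE γ y = 1 →
      (qmap γ)^[n] y = γ ^ n * y - ∑ i ∈ Finset.range n, γ ^ i := by
    intro n
    induction n with
    | zero => intro y _; simp
    | succ n ih =>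
      intro y h
      have hs := qE_step γ y
      have h1 := qE_le γ (qmap γ y)
      have h2 := (qdig_bd γ y).2
      have h3 : qdig γ y = 1 := by linarith
      have h4 : qE γ (qmap γ y) = 1 := by linarith
      rw [Function.iterate_succ_apply, ih _ h4, Finset.sum_range_succ]
      unfold qmap
      rw [h3]; ring
  exact qsum_contra hγ hroot hy (key N y h0)

lemma qE_lt {N : ℕ} {γ y : ℝ} (hγ : γ ∈ Ioo (1 : ℝ) 2)
    (hroot : γ ^ N = ∑ i ∈ Finset.range N, γ ^ i) (hy : y ∈ Ioc (0 : ℝ) 1) :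
    qE γ y < 1 - (1 / 2) ^ N := by
  by_contra hc
  have key : ∀ n : ℕ, ∀ y ∈ Ioc (0 : ℝ) 1, 1 - (1 / 2) ^ n ≤ qE γ y →
      (qmap γ)^[n] y = γ ^ n * y - ∑ i ∈ Finset.range n, γ ^ i := by
    intro n
    induction n with
    | zero => intro y _ _; simp
    | succ n ih =>
      intro y hy h
      have hs := qE_step γ y
      have h1 := qE_lt_one hγ hroot (qmap_mem hγ hy)
      have hp : ((1 : ℝ) / 2) ^ n ≤ 1 := pow_le_one₀ (by norm_num) (by norm_num)
      rw [pow_succ] at h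
      have h3 : qdig γ y = 1 := by
        rcases qdig_or γ y with h3 | h3
        · rw [h3] at hs; exfalso; linarith
        · exact h3
      rw [h3] at hs
      rw [Function.iterate_succ_apply, ih _ (qmap_mem hγ hy) (by linarith), Finset.sum_range_succ]
      unfold qmap
      rw [h3]; ring
  exact qsum_contra hγ hroot hy (key N y hy (not_lt.1 hc))

/-- The conjugacy from quasi-greedy to doubling. -/
def qpsi (γ y : ℝ) : ℝ := 1 - qE γ y

lemma qpsi_facts {N : ℕ} {γ y : ℝ} (hγ : γ ∈ Ioo (1 : ℝ) 2)
    (hroot : γ ^ N = ∑ i ∈ Finset.range N, γ ^ i) (hy : y ∈ Ioc (0 : ℝ) 1) :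
    (1 / 2) ^ N < qpsi γ y ∧ qpsi γ y < 1 ∧ fdig (qpsi γ y) = qdig γ y ∧
      doublingMap (qpsi γ y) = qpsi γ (qmap γ y) := by
  have h1 := qE_lt hγ hroot hy
  have h2 := qE_pos hγ hy
  have h1' := qE_lt_one hγ hroot (qmap_mem hγ hy)
  have h2' := qE_pos hγ (qmap_mem hγ hy)
  have hs := qE_step γ y
  have hp : (0 : ℝ) < (1 / 2) ^ N := by positivity
  refine ⟨by unfold qpsi; linarith, by unfold qpsi; linarith, ?_⟩
  rcases qdig_or γ y with h | h
  · rw [h] at hs ⊢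
    have hh : 1 / 2 ≤ qpsi γ y := by unfold qpsi; linarith
    refine ⟨by unfold fdig; rw [if_neg (not_lt.2 hh)], ?_⟩
    rw [doublingMap_hi hh (by unfold qpsi; linarith)]
    unfold qpsi; linarith
  · rw [h] at hs ⊢
    have hh : qpsi γ y < 1 / 2 := by unfold qpsi; linarith
    refine ⟨by unfold fdig; rw [if_pos hh], ?_⟩
    rw [doublingMap_lo (by unfold qpsi; linarith) hh]
    unfold qpsi; linarith

lemma two_zpow_neg (N : ℕ) : (2 : ℝ) ^ (-(N : ℤ)) = (1 / 2) ^ N := by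
  simp

lemma qpsi_mem {N : ℕ} {γ y : ℝ} (hγ : γ ∈ Ioo (1 : ℝ) 2)
    (hroot : γ ^ N = ∑ i ∈ Finset.range N, γ ^ i) (hy : y ∈ Ioc (0 : ℝ) 1) :
    qpsi γ y ∈ survivorSet ((1 / 2) ^ N) := by
  have hp : (0 : ℝ) < (1 / 2) ^ N := by positivity
  have key : ∀ k : ℕ, ∀ y ∈ Ioc (0 : ℝ) 1, doublingMap^[k] (qpsi γ y) = qpsi γ ((qmap γ)^[k] y) := by
    intro k
    induction k with
    | zero => intro y _; rfl
    | succ k ih =>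
      intro y hy
      rw [Function.iterate_succ_apply, (qpsi_facts hγ hroot hy).2.2.2, ih _ (qmap_mem hγ hy)]
      rfl
  have h := qpsi_facts hγ hroot hy
  refine ⟨⟨by linarith, h.2.1⟩, fun k hk => ?_⟩
  rw [key k y hy] at hk
  have h' := qpsi_facts hγ hroot (qmap_iter_mem hγ k y hy)
  linarith [hk.2]

/-- The Hölder map onto the unit interval. -/
def qphi (γ x : ℝ) : ℝ := digSum γ fdig doublingMap x

lemma zero_of_geom {a K γ : ℝ} (hγ : 1 < γ) (h : ∀ n : ℕ, a ≤ K * γ⁻¹ ^ n) : a ≤ 0 := by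
  have ht : Tendsto (fun n : ℕ => K * γ⁻¹ ^ n) atTop (nhds (K * 0)) :=
    (tendsto_pow_atTop_nhds_zero_of_lt_one (by positivity)
      (inv_lt_one_of_one_lt₀ hγ)).const_mul K
  rw [mul_zero] at ht
  exact ge_of_tendsto' ht h

lemma qphi_qpsi {N : ℕ} {γ y : ℝ} (hγ : γ ∈ Ioo (1 : ℝ) 2)
    (hroot : γ ^ N = ∑ i ∈ Finset.range N, γ ^ i) (hy : y ∈ Ioc (0 : ℝ) 1) :
    qphi γ (qpsi γ y) = y := by
  have hg0 : 0 < γ := by linarith [hγ.1]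
  have key : ∀ n : ℕ, ∀ y ∈ Ioc (0 : ℝ) 1,
      |qphi γ (qpsi γ y) - y| ≤ (1 / (γ - 1) + 1) * γ⁻¹ ^ n := by
    intro n
    induction n with
    | zero =>
      intro y hy
      have h1 := digSum_nonneg (T := doublingMap) hγ.1 fdig_bd (qpsi γ y)
      have h2 := digSum_le (T := doublingMap) hγ.1 fdig_bd (qpsi γ y)
      have h3 : 0 < 1 / (γ - 1) := by have := hγ.1; exact one_div_pos.2 (by linarith)
      have := hy.1
      have := hy.2
      unfold qphi
      rw [pow_zero, abs_le]
      constructor <;> linarith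
    | succ n ih =>
      intro y hy
      have hs : qphi γ (qpsi γ y) = _ := digSum_step (T := doublingMap) hγ.1 fdig_bd (qpsi γ y)
      obtain ⟨-, -, h3, h4⟩ := qpsi_facts hγ hroot hy
      rw [h3, h4] at hs
      have := ih _ (qmap_mem hγ hy)
      have e : qphi γ (qpsi γ y) - y = (qphi γ (qpsi γ (qmap γ y)) - qmap γ y) * γ⁻¹ := by
        rw [hs]
        unfold qphi
        generalize digSum γ fdig doublingMap (qpsi γ (qmap γ y)) = Z
        unfold qmap
        field_simp
        ring
      rw [e, abs_mul, abs_of_pos (inv_pos.2 hg0), pow_succ, ← mul_assoc]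
      gcongr
  have := zero_of_geom hγ.1 (fun n => key n y hy)
  have := abs_nonpos_iff.1 this
  linarith

lemma qphi_holder {N : ℕ} {γ s : ℝ} (hγ : γ ∈ Ioo (1 : ℝ) 2) (hs : (2 : ℝ) ^ s = γ) (hs0 : 0 < s)
    {x x' : ℝ} (hx : x ∈ survivorSet ((1 / 2) ^ N)) (hx' : x' ∈ survivorSet ((1 / 2) ^ N)) :
    |qphi γ x - qphi γ x'| ≤ (1 / (γ - 1) * γ ^ (N + 1)) * |x - x'| ^ s := by
  have hg0 : 0 < γ := by linarith [hγ.1]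
  have hM : 0 < 1 / (γ - 1) := by have := hγ.1; exact one_div_pos.2 (by linarith)
  set M := 1 / (γ - 1) with hMdef
  have hbd : ∀ x x', |qphi γ x - qphi γ x'| ≤ M := by
    intro x x'
    have h1 := digSum_nonneg (T := doublingMap) hγ.1 fdig_bd x
    have h2 := digSum_le (T := doublingMap) hγ.1 fdig_bd x
    have h3 := digSum_nonneg (T := doublingMap) hγ.1 fdig_bd x'
    have h4 := digSum_le (T := doublingMap) hγ.1 fdig_bd x'
    unfold qphi
    rw [abs_le]; constructor <;> linarith
  have hC : 0 < M * γ ^ (N + 1) := by positivity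
  have far : ∀ x x' : ℝ, (1 / 2 : ℝ) ^ (N + 1) ≤ |x - x'| → M ≤ M * γ ^ (N + 1) * |x - x'| ^ s := by
    intro x x' h
    have h1 : ((1 / 2 : ℝ) ^ (N + 1)) ^ s ≤ |x - x'| ^ s :=
      Real.rpow_le_rpow (by positivity) h hs0.le
    have h2 : ((1 / 2 : ℝ) ^ (N + 1)) ^ s = (γ ^ (N + 1))⁻¹ := by
      rw [← hs, one_div, inv_pow, Real.inv_rpow (by positivity), ← Real.rpow_natCast,
        ← Real.rpow_natCast, ← Real.rpow_mul (by norm_num), ← Real.rpow_mul (by norm_num), mul_comm s]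
    rw [h2] at h1
    calc M = M * γ ^ (N + 1) * (γ ^ (N + 1))⁻¹ := by field_simp
      _ ≤ _ := by gcongr
  have key : ∀ n : ℕ, ∀ x ∈ survivorSet ((1 / 2) ^ N), ∀ x' ∈ survivorSet ((1 / 2) ^ N),
      |qphi γ x - qphi γ x'| ≤ M * γ ^ (N + 1) * |x - x'| ^ s + M * γ⁻¹ ^ n := by
    intro n
    induction n with
    | zero =>
      intro x _ x' _
      have := hbd x x'
      have : 0 ≤ M * γ ^ (N + 1) * |x - x'| ^ s := by positivity
      simp only [pow_zero, mul_one]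
      linarith
    | succ n ih =>
      intro x hx x' hx'
      have hq : 0 ≤ M * γ⁻¹ ^ (n + 1) := by positivity
      have same : fdig x = fdig x' → |doublingMap x - doublingMap x'| = 2 * |x - x'| →
          |qphi γ x - qphi γ x'| ≤ M * γ ^ (N + 1) * |x - x'| ^ s + M * γ⁻¹ ^ (n + 1) := by
        intro h1 h2
        have hi := ih _ (survivor_map hx) _ (survivor_map hx')
        rw [h2, Real.mul_rpow (by norm_num) (abs_nonneg _), hs] at hi
        have e : qphi γ x - qphi γ x' =
            (qphi γ (doublingMap x) - qphi γ (doublingMap x')) * γ⁻¹ := by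
          have a : qphi γ x = (fdig x + qphi γ (doublingMap x)) / γ :=
            digSum_step (T := doublingMap) hγ.1 fdig_bd x
          have b : qphi γ x' = (fdig x' + qphi γ (doublingMap x')) / γ :=
            digSum_step (T := doublingMap) hγ.1 fdig_bd x'
          rw [a, b, h1]; field_simp; ring
        rw [e, abs_mul, abs_of_pos (inv_pos.2 hg0)]
        calc _ ≤ (M * γ ^ (N + 1) * (γ * |x - x'| ^ s) + M * γ⁻¹ ^ n) * γ⁻¹ := by gcongr
          _ = _ := by rw [pow_succ γ⁻¹]; field_simp
      have g1 := survivor_gt (survivor_map hx)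
      have g2 := survivor_gt (survivor_map hx')
      rcases lt_or_ge x (1 / 2) with a | a <;> rcases lt_or_ge x' (1 / 2) with b | b
      · apply same
        · unfold fdig; rw [if_pos a, if_pos b]
        · rw [doublingMap_lo hx.1.1 a, doublingMap_lo hx'.1.1 b, ← mul_sub, abs_mul]; norm_num
      · rw [doublingMap_hi b hx'.1.2] at g2
        have := far x x' (by rw [pow_succ, abs_sub_comm]; exact le_trans (by linarith) (le_abs_self _))
        linarith [hbd x x']
      · rw [doublingMap_hi a hx.1.2] at g1
        have := far x x' (by rw [pow_succ]; exact le_trans (by linarith) (le_abs_self _))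
        linarith [hbd x x']
      · apply same
        · unfold fdig; rw [if_neg (not_lt.2 a), if_neg (not_lt.2 b)]
        · rw [doublingMap_hi a hx.1.2, doublingMap_hi b hx'.1.2,
            show 2 * x - 1 - (2 * x' - 1) = 2 * (x - x') by ring, abs_mul]; norm_num
  have := zero_of_geom (K := M) (a := |qphi γ x - qphi γ x'| - M * γ ^ (N + 1) * |x - x'| ^ s)
    hγ.1 (fun n => by linarith [key n x hx x' hx'])
  linarith

lemma lower_bound {N : ℕ} {γ s : ℝ} (hγ : γ ∈ Ioo (1 : ℝ) 2)
    (hroot : γ ^ N = ∑ i ∈ Finset.range N, γ ^ i) (hs : (2 : ℝ) ^ s = γ) (hs0 : 0 < s) :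
    ENNReal.ofReal s ≤ dimH (survivorSet ((1 / 2) ^ N)) := by
  have hg0 : 0 < γ := by linarith [hγ.1]
  have hM : 0 < 1 / (γ - 1) := by have := hγ.1; exact one_div_pos.2 (by linarith)
  have hC : 0 ≤ 1 / (γ - 1) * γ ^ (N + 1) := by positivity
  have hH : HolderOnWith (Real.toNNReal (1 / (γ - 1) * γ ^ (N + 1))) (Real.toNNReal s) (qphi γ)
      (survivorSet ((1 / 2) ^ N)) := by
    intro x hx x' hx'
    have h := qphi_holder hγ hs hs0 hx hx'
    rw [edist_dist, edist_dist, Real.dist_eq, Real.dist_eq, Real.coe_toNNReal _ hs0.le,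
      ENNReal.ofReal_rpow_of_nonneg (abs_nonneg _) hs0.le]
    rw [show ((Real.toNNReal (1 / (γ - 1) * γ ^ (N + 1)) : NNReal) : ENNReal) =
      ENNReal.ofReal (1 / (γ - 1) * γ ^ (N + 1)) from rfl, ← ENNReal.ofReal_mul hC]
    exact ENNReal.ofReal_le_ofReal h
  have h1 := hH.dimH_image_le (Real.toNNReal_pos.2 hs0)
  have h2 : Ioc (0 : ℝ) 1 ⊆ qphi γ '' survivorSet ((1 / 2) ^ N) := fun y hy =>
    ⟨qpsi γ y, qpsi_mem hγ hroot hy, qphi_qpsi hγ hroot hy⟩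
  have h3 : dimH (Ioc (0 : ℝ) 1) = 1 := by
    rw [Real.dimH_of_nonempty_interior]
    · simp
    · rw [interior_Ioc]; exact ⟨1 / 2, by norm_num, by norm_num⟩
  have h4 := (dimH_mono h2).trans h1
  rw [h3, ENNReal.le_div_iff_mul_le (Or.inl _) (Or.inl ENNReal.coe_ne_top), one_mul] at h4
  · exact h4
  · simpa using hs0

/-- Covering sets, by words. -/
def cov (N : ℕ) : (n : ℕ) → (Fin n → Fin N) → Set ℝ
  | 0, _ => Icc 0 1
  | n + 1, w => {x | ∃ y ∈ cov N n (Fin.tail w), x = (1 / 2) ^ ((w 0 : ℕ) + 1) * (1 + y)}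

lemma cov_dist (N : ℕ) : ∀ (n : ℕ) (w : Fin n → Fin N), ∀ x ∈ cov N n w, ∀ y ∈ cov N n w,
    |x - y| ≤ ∏ i, (1 / 2 : ℝ) ^ ((w i : ℕ) + 1) := by
  intro n
  induction n with
  | zero =>
    intro w x hx y hy
    obtain ⟨h1, h2⟩ := hx
    obtain ⟨h3, h4⟩ := hy
    simp only [Finset.univ_eq_empty, Finset.prod_empty]
    rw [abs_le]; constructor <;> linarith
  | succ n ih =>
    rintro w x ⟨a, ha, rfl⟩ y ⟨b, hb, rfl⟩
    rw [← mul_sub, abs_mul, abs_of_pos (by positivity), Fin.prod_univ_succ]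
    have := ih _ a ha b hb
    rw [show 1 + a - (1 + b) = a - b by ring]
    gcongr
    exact this

lemma iter_lo {x : ℝ} (h0 : 0 ≤ x) : ∀ i : ℕ, (∀ j < i, doublingMap^[j] x < 1 / 2) →
    doublingMap^[i] x = 2 ^ i * x := by
  intro i
  induction i with
  | zero => intro _; simp
  | succ i ih =>
    intro h
    have hi := ih (fun j hj => h j (by omega))
    have hl := h i (by omega)
    rw [Function.iterate_succ_apply', doublingMap_lo (by rw [hi]; positivity) hl, hi]
    ring

lemma survivor_iter {ε x : ℝ} (h : x ∈ survivorSet ε) (k : ℕ) :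
    doublingMap^[k] x ∈ survivorSet ε := by
  induction k with
  | zero => exact h
  | succ k ih => rw [Function.iterate_succ_apply']; exact survivor_map ih

lemma survivor_decomp {N : ℕ} {x : ℝ} (h : x ∈ survivorSet ((1 / 2) ^ N)) :
    ∃ i : Fin N, ∃ y ∈ survivorSet ((1 / 2) ^ N), x = (1 / 2) ^ ((i : ℕ) + 1) * (1 + y) := by
  classical
  have hex : ∃ i, i < N ∧ 1 / 2 ≤ doublingMap^[i] x := by
    by_contra hc
    push Not at hc
    have h1 := iter_lo h.1.1 N hc
    have h2 := (survivor_iter h N).1.2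
    have h3 := survivor_gt h
    rw [h1] at h2
    have : (2 : ℝ) ^ N * (1 / 2) ^ N = 1 := by rw [← mul_pow]; norm_num
    have hp : (0 : ℝ) < 2 ^ N := by positivity
    nlinarith
  obtain ⟨i, hi⟩ : ∃ i, i = Nat.find hex := ⟨_, rfl⟩
  have hf := Nat.find_spec hex
  rw [← hi] at hf
  obtain ⟨hf1, hf2⟩ := hf
  have hmin : ∀ j < i, doublingMap^[j] x < 1 / 2 := by
    intro j hj
    have := Nat.find_min hex (hi ▸ hj)
    by_contra hc
    exact this ⟨by omega, not_lt.1 hc⟩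
  refine ⟨⟨i, hf1⟩, doublingMap^[i + 1] x, survivor_iter h _, ?_⟩
  rw [Function.iterate_succ_apply', doublingMap_hi hf2 (survivor_iter h i).1.2,
    iter_lo h.1.1 i hmin]
  have : (2 : ℝ) ^ i * (1 / 2) ^ i = 1 := by rw [← mul_pow]; norm_num
  simp only [pow_succ]
  linear_combination (-x) * this

lemma cov_cover (N : ℕ) : ∀ (n : ℕ), ∀ x ∈ survivorSet ((1 / 2) ^ N), ∃ w, x ∈ cov N n w := by
  intro n
  induction n with
  | zero => intro x hx; exact ⟨Fin.elim0, hx.1.1, hx.1.2.le⟩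
  | succ n ih =>
    intro x hx
    obtain ⟨i, y, hy, e⟩ := survivor_decomp hx
    obtain ⟨w, hw⟩ := ih y hy
    exact ⟨Fin.cons i w, y, by simpa using hw, by simpa using e⟩

lemma upper_bound {N : ℕ} {γ s : ℝ} (hγ : γ ∈ Ioo (1 : ℝ) 2)
    (hroot : γ ^ N = ∑ i ∈ Finset.range N, γ ^ i) (hs : (2 : ℝ) ^ s = γ) (hs0 : 0 < s) :
    dimH (survivorSet ((1 / 2) ^ N)) ≤ ENNReal.ofReal s := by
  have hg0 : 0 < γ := by linarith [hγ.1]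
  have hdiam : ∀ n (w : Fin n → Fin N), Metric.ediam (cov N n w) ≤
      ENNReal.ofReal (∏ i, (1 / 2 : ℝ) ^ ((w i : ℕ) + 1)) := by
    intro n w
    refine Metric.ediam_le fun x hx y hy => ?_
    rw [edist_dist, Real.dist_eq]
    exact ENNReal.ofReal_le_ofReal (cov_dist N n w x hx y hy)
  have hsmall : ∀ n (w : Fin n → Fin N), ∏ i, (1 / 2 : ℝ) ^ ((w i : ℕ) + 1) ≤ (1 / 2) ^ n := by
    intro n w
    calc _ ≤ ∏ i : Fin n, (1 / 2 : ℝ) := by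
          refine Finset.prod_le_prod (fun _ _ => by positivity) fun i _ => ?_
          exact pow_le_of_le_one (by norm_num) (by norm_num) (by omega)
      _ = _ := by simp
  have hone : ∑ i : Fin N, (γ⁻¹) ^ ((i : ℕ) + 1) = 1 := by
    rw [Fin.sum_univ_eq_sum_range (fun i => γ⁻¹ ^ (i + 1)) N]
    rw [← Finset.sum_range_reflect]
    have : ∀ j ∈ Finset.range N, γ⁻¹ ^ (N - 1 - j + 1) = γ ^ j * (γ ^ N)⁻¹ := by
      intro j hj
      have hj := Finset.mem_range.1 hj
      have e : N - 1 - j + 1 + j = N := by omega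
      rw [inv_pow, inv_eq_iff_eq_inv, mul_inv, inv_inv]
      field_simp
      rw [← pow_add, e]
    rw [Finset.sum_congr rfl this, ← Finset.sum_mul, ← hroot]
    field_simp
  have hsum : ∀ n, ∑ w : Fin n → Fin N, Metric.ediam (cov N n w) ^ s ≤ 1 := by
    intro n
    calc _ ≤ ∑ w : Fin n → Fin N, ENNReal.ofReal (∏ i, (γ⁻¹) ^ ((w i : ℕ) + 1)) := by
          refine Finset.sum_le_sum fun w _ => ?_
          refine (ENNReal.rpow_le_rpow (hdiam n w) hs0.le).trans ?_
          rw [ENNReal.ofReal_rpow_of_nonneg (by positivity) hs0.le]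
          refine ENNReal.ofReal_le_ofReal (le_of_eq ?_)
          rw [← Real.finsetProd_rpow _ _ (fun _ _ => by positivity)]
          refine Finset.prod_congr rfl fun i _ => ?_
          rw [← hs, one_div, inv_pow, inv_pow, Real.inv_rpow (by positivity), ← Real.rpow_natCast,
            ← Real.rpow_natCast, ← Real.rpow_mul (by norm_num), ← Real.rpow_mul (by norm_num),
            mul_comm s]
      _ = ENNReal.ofReal (∑ w : Fin n → Fin N, ∏ i, (γ⁻¹) ^ ((w i : ℕ) + 1)) :=
          (ENNReal.ofReal_sum_of_nonneg fun _ _ => by positivity).symm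
      _ = 1 := by
          rw [← Fintype.prod_sum (fun (_ : Fin n) (j : Fin N) => γ⁻¹ ^ ((j : ℕ) + 1))]
          simp only [hone, Finset.prod_const_one, ENNReal.ofReal_one]
      _ ≤ 1 := le_rfl
  have hm : μH[s] (survivorSet ((1 / 2) ^ N)) ≤ 1 := by
    refine (Measure.hausdorffMeasure_le_liminf_sum (β := ℕ) (ι := fun n => Fin n → Fin N) s _
      (l := atTop) (fun n => ENNReal.ofReal ((1 / 2) ^ n)) ?_ (cov N) ?_ ?_).trans ?_
    · rw [← ENNReal.ofReal_zero]
      exact ENNReal.tendsto_ofReal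
        (tendsto_pow_atTop_nhds_zero_of_lt_one (by norm_num) (by norm_num))
    · exact Eventually.of_forall fun n w =>
        (hdiam n w).trans (ENNReal.ofReal_le_ofReal (hsmall n w))
    · exact Eventually.of_forall fun n x hx => mem_iUnion.2 (cov_cover N n x hx)
    · calc _ ≤ liminf (fun _ : ℕ => (1 : ENNReal)) atTop :=
            liminf_le_liminf (Eventually.of_forall hsum)
        _ = 1 := liminf_const _
  have := dimH_le_of_hausdorffMeasure_ne_top (d := Real.toNNReal s)
    (s := survivorSet ((1 / 2) ^ N)) (by
      rw [Real.coe_toNNReal _ hs0.le]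
      exact ne_top_of_le_ne_top ENNReal.one_ne_top hm)
  exact this

/-- For every `N ≥ 2`, `dim_H D_{2^{-N}} = log γ_N / log 2`, where
`γ_N ∈ (1,2)` is the N-bonacci number, i.e. the root of `x^N = x^{N-1} + ⋯ + x + 1`. -/
theorem dimH_survivorSet_doubling (N : ℕ) (hN : 2 ≤ N) (γ : ℝ) (hγ : γ ∈ Ioo (1 : ℝ) 2)
    (hroot : γ ^ N = ∑ i ∈ Finset.range N, γ ^ i) :
    dimH (survivorSet ((2 : ℝ) ^ (-(N : ℤ)))) =
      ENNReal.ofReal (Real.log γ / Real.log 2) := by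
  have h2 : 0 < Real.log 2 := Real.log_pos (by norm_num)
  have hs0 : 0 < Real.log γ / Real.log 2 := div_pos (Real.log_pos hγ.1) h2
  have hs : (2 : ℝ) ^ (Real.log γ / Real.log 2) = γ := by
    rw [Real.rpow_def_of_pos (by norm_num), mul_div_cancel₀ _ h2.ne',
      Real.exp_log (by linarith [hγ.1])]
  rw [two_zpow_neg]
  exact le_antisymm (upper_bound hγ hroot hs hs0) (lower_bound hγ hroot hs hs0)
end
end

section
/- Let n ≥ 2 and N > 2n+4 be integers, let β = β_n be the n-bonacci number, and define the contractions g_1(x) = x/β^{n+2} + 1/β and g_2(x) = x/β^N + 1/β on ℝ. Then there exists a nonempty compact set J ⊆ ℝ with J = g_1(J) ∪ g_2(J), and its Hausdorff dimension equals s, where s is the unique positive real number satisfying β^{−(n+2)s} + β^{−Ns} = 1; in particular s > 0. -/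
open MeasureTheory Set Filter

noncomputable section

/-- `β` is the n-bonacci number: the root in (1,2) of `β^n = β^{n-1} + ⋯ + β + 1`. -/
def IsNBonacci (n : ℕ) (β : ℝ) : Prop :=
  β ∈ Ioo (1 : ℝ) 2 ∧ β ^ n = ∑ i ∈ Finset.range n, β ^ i

/-- Coding map of the IFS `x ↦ a i * x + b i`. -/
def codeMap (a b : Bool → ℝ) (w : ℕ → Bool) : ℝ :=
  ∑' k, (∏ j ∈ Finset.range k, a (w j)) * b (w k)

/-- Prepend a symbol. -/
def consW (i : Bool) (w : ℕ → Bool) : ℕ → Bool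
  | 0 => i
  | k + 1 => w k

/-- Shift. -/
def shiftW (w : ℕ → Bool) : ℕ → Bool := fun k => w (k + 1)

lemma consW_shiftW (w : ℕ → Bool) : consW (w 0) (shiftW w) = w := by
  funext k
  cases k <;> rfl

lemma shiftW_consW (i : Bool) (w : ℕ → Bool) : shiftW (consW i w) = w := rfl

lemma term_bound {a b : Bool → ℝ} {ρ B : ℝ} (ha0 : ∀ i, 0 ≤ a i)
    (ha : ∀ i, a i ≤ ρ) (hb : ∀ i, |b i| ≤ B) (w : ℕ → Bool) (k : ℕ) :
    ‖(∏ j ∈ Finset.range k, a (w j)) * b (w k)‖ ≤ ρ ^ k * B := by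
  have h0 : 0 ≤ ∏ j ∈ Finset.range k, a (w j) := Finset.prod_nonneg fun _ _ => ha0 _
  have h1 : ∏ j ∈ Finset.range k, a (w j) ≤ ρ ^ k := by
    calc _ ≤ ∏ j ∈ Finset.range k, ρ := Finset.prod_le_prod (fun _ _ => ha0 _) fun _ _ => ha _
      _ = ρ ^ k := by simp
  rw [norm_mul, Real.norm_eq_abs, Real.norm_eq_abs, abs_of_nonneg h0]
  exact mul_le_mul h1 (hb _) (abs_nonneg _) (h0.trans h1)

lemma summable_geo {ρ B : ℝ} (h0 : 0 ≤ ρ) (h1 : ρ < 1) : Summable fun k : ℕ => ρ ^ k * B :=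
  (summable_geometric_of_lt_one h0 h1).mul_right B

lemma code_summable_s16 {a b : Bool → ℝ} {ρ B : ℝ} (ha0 : ∀ i, 0 ≤ a i)
    (ha : ∀ i, a i ≤ ρ) (hρ : ρ < 1) (hb : ∀ i, |b i| ≤ B) (w : ℕ → Bool) :
    Summable fun k => (∏ j ∈ Finset.range k, a (w j)) * b (w k) :=
  Summable.of_norm_bounded (summable_geo ((ha0 true).trans (ha true)) hρ)
    (term_bound ha0 ha hb w)

lemma code_abs_le {a b : Bool → ℝ} {ρ B : ℝ} (ha0 : ∀ i, 0 ≤ a i)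
    (ha : ∀ i, a i ≤ ρ) (hρ : ρ < 1) (hb : ∀ i, |b i| ≤ B) (w : ℕ → Bool) :
    |codeMap a b w| ≤ B / (1 - ρ) := by
  have h0 := (ha0 true).trans (ha true)
  have := tsum_of_norm_bounded (f := fun k => (∏ j ∈ Finset.range k, a (w j)) * b (w k))
    (summable_geo (B := B) h0 hρ).hasSum (term_bound ha0 ha hb w)
  rw [tsum_mul_right, tsum_geometric_of_lt_one h0 hρ] at this
  rw [div_eq_inv_mul]
  exact this

lemma code_rec {a b : Bool → ℝ} {ρ B : ℝ} (ha0 : ∀ i, 0 ≤ a i)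
    (ha : ∀ i, a i ≤ ρ) (hρ : ρ < 1) (hb : ∀ i, |b i| ≤ B) (w : ℕ → Bool) :
    codeMap a b w = a (w 0) * codeMap a b (shiftW w) + b (w 0) := by
  unfold codeMap
  rw [(code_summable_s16 ha0 ha hρ hb w).tsum_eq_zero_add, ← tsum_mul_left, add_comm]
  congr 1
  · apply tsum_congr
    intro k
    rw [Finset.prod_range_succ']
    simp only [shiftW]
    ring
  · simp

lemma code_continuous {a b : Bool → ℝ} {ρ B : ℝ} (ha0 : ∀ i, 0 ≤ a i)
    (ha : ∀ i, a i ≤ ρ) (hρ : ρ < 1) (hb : ∀ i, |b i| ≤ B) : Continuous (codeMap a b) := by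
  refine continuous_tsum (fun k => ?_) (summable_geo (B := B) ((ha0 true).trans (ha true)) hρ)
    (fun k w => term_bound ha0 ha hb w k)
  have h : ∀ (c : Bool → ℝ) (j : ℕ), Continuous fun w : ℕ → Bool => c (w j) := fun c j =>
    (continuous_of_discreteTopology (f := c)).comp (continuous_apply j)
  exact (continuous_finsetProd _ fun j _ => h a j).mul (h b k)

lemma code_diff {a b : Bool → ℝ} {ρ B : ℝ} (ha0 : ∀ i, 0 ≤ a i)
    (ha : ∀ i, a i ≤ ρ) (hρ : ρ < 1) (hb : ∀ i, |b i| ≤ B) (m : ℕ) : ∀ (w w' : ℕ → Bool),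
    (∀ j < m, w j = w' j) → |codeMap a b w - codeMap a b w'| ≤
      (∏ j ∈ Finset.range m, a (w j)) * (2 * (B / (1 - ρ))) := by
  induction m with
  | zero =>
    intro w w' _
    have h1 := abs_le.1 (code_abs_le ha0 ha hρ hb w)
    have h2 := abs_le.1 (code_abs_le ha0 ha hρ hb w')
    simp only [Finset.range_zero, Finset.prod_empty, one_mul]
    rw [abs_le]
    constructor <;> linarith
  | succ m ih =>
    intro w w' h
    have := ih (shiftW w) (shiftW w') (fun j hj => h (j + 1) (by omega))
    rw [code_rec ha0 ha hρ hb w, code_rec ha0 ha hρ hb w', ← h 0 (by omega),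
      Finset.prod_range_succ']
    have e : a (w 0) * codeMap a b (shiftW w) + b (w 0) -
      (a (w 0) * codeMap a b (shiftW w') + b (w 0)) =
      a (w 0) * (codeMap a b (shiftW w) - codeMap a b (shiftW w')) := by ring
    rw [e, abs_mul, abs_of_nonneg (ha0 _)]
    calc _ ≤ _ := mul_le_mul_of_nonneg_left this (ha0 (w 0))
      _ = _ := by simp only [shiftW]; ring

/-- Hölder estimate between two codings. -/
lemma code_holder_s16 {a b A D : Bool → ℝ} {ρ B ρ' B' s δ : ℝ} (ha0 : ∀ i, 0 ≤ a i)
    (ha : ∀ i, a i ≤ ρ) (hρ : ρ < 1) (hb : ∀ i, |b i| ≤ B) (hA0 : ∀ i, 0 ≤ A i)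
    (hA : ∀ i, A i ≤ ρ') (hρ' : ρ' < 1) (hD : ∀ i, |D i| ≤ B') (hs : 0 < s)
    (hAa : ∀ i, A i = a i ^ s) (hδ : 0 < δ)
    (hsep : ∀ w w' : ℕ → Bool, w 0 ≠ w' 0 → δ ≤ |codeMap a b w - codeMap a b w'|)
    (w w' : ℕ → Bool) :
    |codeMap A D w - codeMap A D w'| ≤
      (2 * (B' / (1 - ρ')) / δ ^ s) * |codeMap a b w - codeMap a b w'| ^ s := by
  have hB' : 0 ≤ B' := (abs_nonneg _).trans (hD true)
  have hC : 0 ≤ 2 * (B' / (1 - ρ')) := by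
    have : 0 < 1 - ρ' := by linarith
    positivity
  have hδs : 0 < δ ^ s := Real.rpow_pos_of_pos hδ s
  have key : ∀ (k : ℕ) (w w' : ℕ → Bool), w k ≠ w' k → 
    |codeMap A D w - codeMap A D w'| ≤
      (2 * (B' / (1 - ρ')) / δ ^ s) * |codeMap a b w - codeMap a b w'| ^ s := by
    have base : ∀ (w w' : ℕ → Bool), w 0 ≠ w' 0 → 
      |codeMap A D w - codeMap A D w'| ≤
      (2 * (B' / (1 - ρ')) / δ ^ s) * |codeMap a b w - codeMap a b w'| ^ s := by
      intro w w' h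
      have h1 := code_diff hA0 hA hρ' hD 0 w w' (by simp)
      simp only [Finset.range_zero, Finset.prod_empty, one_mul] at h1
      have h2 := Real.rpow_le_rpow hδ.le (hsep w w' h) hs.le
      refine h1.trans ?_
      rw [div_mul_eq_mul_div, le_div_iff₀ hδs]
      exact mul_le_mul_of_nonneg_left h2 hC
    intro k
    induction k with
    | zero => exact base
    | succ k ih =>
      intro w w' h
      by_cases h0 : w 0 = w' 0
      · have := ih (shiftW w) (shiftW w') h
        rw [code_rec ha0 ha hρ hb w, code_rec ha0 ha hρ hb w', code_rec hA0 hA hρ' hD w,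
          code_rec hA0 hA hρ' hD w', ← h0]
        rw [add_sub_add_right_eq_sub, add_sub_add_right_eq_sub, ← mul_sub, ← mul_sub, abs_mul,
          abs_mul, abs_of_nonneg (ha0 _), abs_of_nonneg (hA0 _),
          Real.mul_rpow (ha0 _) (abs_nonneg _), ← hAa]
        calc _ ≤ _ := mul_le_mul_of_nonneg_left this (hA0 (w 0))
          _ = _ := by ring
      · exact base w w' h0
  by_cases h : w = w'
  · subst h
    simp [Real.zero_rpow hs.ne']
  · obtain ⟨k, hk⟩ := Function.ne_iff.1 h
    exact key k w w' hk

/-- The coding with weights `p, q` is onto the unit interval. -/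
lemma code_onto {p q : ℝ} (hp : 0 < p) (hq : 0 < q) (hpq : p + q = 1) :
    Icc (0 : ℝ) 1 ⊆
      range (codeMap (fun i => if i then p else q) (fun i => if i then q else 0)) := by
  set A : Bool → ℝ := fun i => if i then p else q with hAdef
  set D : Bool → ℝ := fun i => if i then q else 0 with hDdef
  have hA0 : ∀ i, 0 ≤ A i := by intro i; cases i <;> simp [hAdef, hp.le, hq.le]
  have hA : ∀ i, A i ≤ max p q := by intro i; cases i <;> simp [hAdef]
  have hρ : max p q < 1 := max_lt (by linarith) (by linarith)
  have hD : ∀ i, |D i| ≤ q := by intro i; cases i <;> simp [hDdef, hq.le, abs_of_pos hq]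
  have hM0 : 0 ≤ max p q := hp.le.trans (le_max_left _ _)
  set C := q / (1 - max p q) + 1 with hC
  have approx : ∀ (m : ℕ) (x : ℝ), x ∈ Icc (0 : ℝ) 1 →
      ∃ w, |codeMap A D w - x| ≤ max p q ^ m * C := by
    intro m
    induction m with
    | zero =>
      intro x hx
      refine ⟨fun _ => true, ?_⟩
      have := abs_le.1 (code_abs_le hA0 hA hρ hD (fun _ => true))
      rw [abs_le]
      obtain ⟨h1, h2⟩ := hx
      constructor <;> simp only [pow_zero, one_mul, hC] <;> linarith
    | succ m ih =>
      have step : ∀ (i : Bool) (y : ℝ), y ∈ Icc (0 : ℝ) 1 →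
          ∃ w, |codeMap A D w - (A i * y + D i)| ≤ max p q ^ (m + 1) * C := by
        intro i y hy
        obtain ⟨w, hw⟩ := ih y hy
        refine ⟨consW i w, ?_⟩
        rw [code_rec hA0 hA hρ hD, shiftW_consW]
        change |A i * codeMap A D w + D i - (A i * y + D i)| ≤ _
        rw [add_sub_add_right_eq_sub, ← mul_sub, abs_mul, abs_of_nonneg (hA0 _)]
        calc _ ≤ max p q * (max p q ^ m * C) := mul_le_mul (hA i) hw (abs_nonneg _) hM0
          _ = _ := by ring
      intro x hx
      obtain ⟨h1, h2⟩ := hx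
      by_cases hxq : x ≤ q
      · have := step false (x / q) ⟨by positivity, (div_le_one hq).2 hxq⟩
        have e : A false * (x / q) + D false = x := by
          simp [hAdef, hDdef]; field_simp
        rwa [e] at this
      · push Not at hxq
        have := step true ((x - q) / p)
          ⟨div_nonneg (by linarith) hp.le, (div_le_one hp).2 (by linarith)⟩
        have e : A true * ((x - q) / p) + D true = x := by
          simp [hAdef, hDdef]; field_simp; ring
        rwa [e] at this
  intro x hx
  have hcl : IsClosed (range (codeMap A D)) :=
    (isCompact_range (code_continuous hA0 hA hρ hD)).isClosed
  rw [← hcl.closure_eq, Metric.mem_closure_iff]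
  intro ε hε
  have ht : Tendsto (fun m : ℕ => max p q ^ m * C) atTop (nhds 0) := by
    simpa using (tendsto_pow_atTop_nhds_zero_of_lt_one hM0 hρ).mul_const C
  obtain ⟨m, hm⟩ := (ht.eventually (gt_mem_nhds hε)).exists
  obtain ⟨w, hw⟩ := approx m x hx
  refine ⟨_, ⟨w, rfl⟩, ?_⟩
  rw [dist_comm, Real.dist_eq]
  exact hw.trans_lt hm

lemma code_dim_lower {a b : Bool → ℝ} {ρ B s δ : ℝ} (ha0 : ∀ i, 0 < a i)
    (ha : ∀ i, a i ≤ ρ) (hρ : ρ < 1) (hb : ∀ i, |b i| ≤ B) (hs : 0 < s)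
    (hsum : a true ^ s + a false ^ s = 1) (hδ : 0 < δ)
    (hsep : ∀ w w' : ℕ → Bool, w 0 ≠ w' 0 → δ ≤ |codeMap a b w - codeMap a b w'|) :
    ENNReal.ofReal s ≤ dimH (range (codeMap a b)) := by
  have hp : 0 < a true ^ s := Real.rpow_pos_of_pos (ha0 _) s
  have hq : 0 < a false ^ s := Real.rpow_pos_of_pos (ha0 _) s
  have honto := code_onto hp hq hsum
  set A : Bool → ℝ := fun i => if i then a true ^ s else a false ^ s with hAdef
  set D : Bool → ℝ := fun i => if i then a false ^ s else 0 with hDdef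
  have hAa : ∀ i, A i = a i ^ s := by intro i; cases i <;> simp [hAdef]
  have hA0 : ∀ i, 0 ≤ A i := by intro i; cases i <;> simp [hAdef, hp.le, hq.le]
  have hA : ∀ i, A i ≤ max (a true ^ s) (a false ^ s) := by intro i; cases i <;> simp [hAdef]
  have hρ' : max (a true ^ s) (a false ^ s) < 1 := max_lt (by linarith) (by linarith)
  have hD : ∀ i, |D i| ≤ a false ^ s := by
    intro i; cases i <;> simp [hDdef, hq.le, abs_of_pos hq]
  have hold := code_holder_s16 (fun i => (ha0 i).le) ha hρ hb hA0 hA hρ' hD hs hAa hδ hsep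
  set C := 2 * (a false ^ s / (1 - max (a true ^ s) (a false ^ s))) / δ ^ s with hC
  have hC0 : 0 ≤ C := by
    have : 0 < 1 - max (a true ^ s) (a false ^ s) := by linarith
    positivity
  set f : ℝ → ℝ := fun x => codeMap A D (Function.invFun (codeMap a b) x) with hf
  have hinv : ∀ w, codeMap a b (Function.invFun (codeMap a b) (codeMap a b w)) = codeMap a b w :=
    fun w => Function.invFun_eq ⟨w, rfl⟩
  have hfw : ∀ w, f (codeMap a b w) = codeMap A D w := by
    intro w
    have := hold (Function.invFun (codeMap a b) (codeMap a b w)) w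
    rw [hinv, sub_self, abs_zero, Real.zero_rpow hs.ne', mul_zero] at this
    exact sub_eq_zero.1 (abs_eq_zero.1 (le_antisymm this (abs_nonneg _)))
  have hH : HolderOnWith (Real.toNNReal C) (Real.toNNReal s) f (range (codeMap a b)) := by
    rintro _ ⟨w, rfl⟩ _ ⟨w', rfl⟩
    rw [hfw, hfw, edist_dist, edist_dist, Real.dist_eq, Real.dist_eq, Real.coe_toNNReal s hs.le,
      ENNReal.ofReal_rpow_of_nonneg (abs_nonneg _) hs.le]
    change _ ≤ ENNReal.ofReal C * _
    rw [← ENNReal.ofReal_mul hC0]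
    exact ENNReal.ofReal_le_ofReal (hold w w')
  have h1 := hH.dimH_image_le (Real.toNNReal_pos.2 hs)
  have h2 : Icc (0 : ℝ) 1 ⊆ f '' range (codeMap a b) := by
    intro x hx
    obtain ⟨w, rfl⟩ := honto hx
    exact ⟨_, ⟨w, rfl⟩, hfw w⟩
  have h3 : (1 : ENNReal) ≤ dimH (range (codeMap a b)) / (Real.toNNReal s) := by
    have : dimH (Icc (0 : ℝ) 1) = 1 := by
      rw [Real.dimH_of_mem_nhds (x := (1 / 2 : ℝ)) (Icc_mem_nhds (by norm_num) (by norm_num))]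
      simp
    rw [← this]
    exact (dimH_mono h2).trans h1
  have hs0 : ((Real.toNNReal s : NNReal) : ENNReal) ≠ 0 := by
    simpa using hs
  rw [ENNReal.le_div_iff_mul_le (Or.inl hs0) (Or.inl ENNReal.coe_ne_top), one_mul] at h3
  exact h3

lemma code_dim_upper {a b : Bool → ℝ} {ρ B s : ℝ} (ha0 : ∀ i, 0 < a i)
    (ha : ∀ i, a i ≤ ρ) (hρ : ρ < 1) (hb : ∀ i, |b i| ≤ B) (hs : 0 < s)
    (hsum : a true ^ s + a false ^ s = 1) :
    dimH (range (codeMap a b)) ≤ ENNReal.ofReal s := by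
  have hρ0 : 0 ≤ ρ := (ha0 true).le.trans (ha true)
  have ha0' := fun i => (ha0 i).le
  set C := 2 * (B / (1 - ρ)) with hC
  have hC0 : 0 ≤ C := by
    have : 0 < 1 - ρ := by linarith
    have : 0 ≤ B := (abs_nonneg _).trans (hb true)
    positivity
  have hprod0 : ∀ (m : ℕ) (v : Fin m → Bool), 0 ≤ ∏ j, a (v j) := fun m v =>
    Finset.prod_nonneg fun _ _ => ha0' _
  let t : ∀ m : ℕ, (Fin m → Bool) → Set ℝ := fun m v =>
    codeMap a b '' {w | ∀ j : Fin m, w j = v j}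
  have hdiam : ∀ m v, Metric.ediam (t m v) ≤ ENNReal.ofReal ((∏ j, a (v j)) * C) := by
    intro m v
    apply Metric.ediam_le
    rintro _ ⟨w, hw, rfl⟩ _ ⟨w', hw', rfl⟩
    rw [edist_dist, Real.dist_eq]
    apply ENNReal.ofReal_le_ofReal
    have := code_diff ha0' ha hρ hb m w w'
      (fun j hj => (hw ⟨j, hj⟩).trans (hw' ⟨j, hj⟩).symm)
    rw [Finset.prod_range] at this
    have e : ∏ j : Fin m, a (w j) = ∏ j, a (v j) := Finset.prod_congr rfl fun j _ => by rw [hw j]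
    rwa [e] at this
  have hle : ∀ m (v : Fin m → Bool), (∏ j, a (v j)) ≤ ρ ^ m := by
    intro m v
    calc _ ≤ ∏ j : Fin m, ρ := Finset.prod_le_prod (fun _ _ => ha0' _) fun _ _ => ha _
      _ = ρ ^ m := by simp
  have hr : Tendsto (fun m : ℕ => ENNReal.ofReal (ρ ^ m * C)) atTop (nhds 0) := by
    rw [← ENNReal.ofReal_zero]
    apply ENNReal.tendsto_ofReal
    simpa using (tendsto_pow_atTop_nhds_zero_of_lt_one hρ0 hρ).mul_const C
  have hμ := Measure.hausdorffMeasure_le_liminf_sum s (range (codeMap a b)) _ hr t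
    (Eventually.of_forall fun m v => (hdiam m v).trans
      (ENNReal.ofReal_le_ofReal (mul_le_mul_of_nonneg_right (hle m v) hC0)))
    (Eventually.of_forall fun m => by
      rintro _ ⟨w, rfl⟩
      exact mem_iUnion.2 ⟨fun j => w j, ⟨w, fun _ => rfl, rfl⟩⟩)
  have hS : ∀ m, ∑ v, Metric.ediam (t m v) ^ s ≤ ENNReal.ofReal (C ^ s) := by
    intro m
    calc _ ≤ ∑ v : Fin m → Bool, ENNReal.ofReal ((∏ j, a (v j) ^ s) * C ^ s) := by
          apply Finset.sum_le_sum
          intro v _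
          refine (ENNReal.rpow_le_rpow (hdiam m v) hs.le).trans ?_
          rw [ENNReal.ofReal_rpow_of_nonneg (mul_nonneg (hprod0 m v) hC0) hs.le,
            Real.mul_rpow (hprod0 m v) hC0, Real.finsetProd_rpow _ _ (fun _ _ => ha0' _)]
      _ = ENNReal.ofReal (∑ v : Fin m → Bool, (∏ j, a (v j) ^ s) * C ^ s) := by
          rw [ENNReal.ofReal_sum_of_nonneg]
          intro v _
          exact mul_nonneg (Finset.prod_nonneg fun _ _ => Real.rpow_nonneg (ha0' _) _)
            (Real.rpow_nonneg hC0 _)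
      _ = ENNReal.ofReal (C ^ s) := by
          rw [← Finset.sum_mul, ← Fintype.sum_pow (fun i => a i ^ s) m]
          simp [hsum]
  have hfin : Measure.hausdorffMeasure s (range (codeMap a b)) ≤ ENNReal.ofReal (C ^ s) :=
    hμ.trans ((liminf_le_liminf (Eventually.of_forall hS)).trans (by simp))
  apply dimH_le_of_hausdorffMeasure_ne_top (d := Real.toNNReal s)
  rw [Real.coe_toNNReal s hs.le]
  exact (hfin.trans_lt ENNReal.ofReal_lt_top).ne

/-- For `n ≥ 2`, `N > 2n+4` and `β = β_n`, with the contractions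
`g₁ x = x/β^{n+2} + 1/β` and `g₂ x = x/β^N + 1/β`: there is a unique positive real `s`
with `β^{-(n+2)s} + β^{-Ns} = 1`, and for this `s` there exists a nonempty compact set
`J ⊆ ℝ` with `J = g₁(J) ∪ g₂(J)` whose Hausdorff dimension equals `s` (and `s > 0`). -/
theorem attractor_dimH_eq (n N : ℕ) (hn : 2 ≤ n) (hN : 2 * n + 4 < N) (β : ℝ)
    (hβ : IsNBonacci n β) :
    (∃! s : ℝ, 0 < s ∧ β ^ (-(((n : ℝ) + 2)) * s) + β ^ (-(N : ℝ) * s) = 1) ∧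
    ∀ s : ℝ, 0 < s → β ^ (-(((n : ℝ) + 2)) * s) + β ^ (-(N : ℝ) * s) = 1 →
      ∃ J : Set ℝ, J.Nonempty ∧ IsCompact J ∧
        J = (fun x => x / β ^ (n + 2) + 1 / β) '' J ∪ (fun x => x / β ^ N + 1 / β) '' J ∧
        dimH J = ENNReal.ofReal s := by
  obtain ⟨⟨hβ1, hβ2⟩, hβn⟩ := hβ
  have hβ0 : 0 < β := by linarith
  have hn2 : (2 : ℝ) ≤ β ^ n := by
    rw [hβn]
    calc (2 : ℝ) ≤ n := by exact_mod_cast hn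
      _ = ∑ i ∈ Finset.range n, (1 : ℝ) := by simp
      _ ≤ _ := Finset.sum_le_sum fun i _ => one_le_pow₀ hβ1.le
  have hr2 : 2 < β ^ (n + 2) :=
    hn2.trans_lt (pow_lt_pow_right₀ hβ1 (by omega))
  have hN2 : 2 < β ^ N := hn2.trans_lt (pow_lt_pow_right₀ hβ1 (by omega))
  have hconv : ∀ (k : ℕ) (s : ℝ), β ^ (-(k : ℝ) * s) = ((β ^ k)⁻¹) ^ s := by
    intro k s
    rw [Real.rpow_mul hβ0.le, Real.rpow_neg hβ0.le, Real.rpow_natCast]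
  have hconv2 : ∀ s : ℝ, β ^ (-((n : ℝ) + 2) * s) = ((β ^ (n + 2))⁻¹) ^ s := by
    intro s
    rw [← hconv]
    push_cast
    rfl
  simp only [hconv, hconv2]
  set r := (β ^ (n + 2))⁻¹ with hr
  set u := (β ^ N)⁻¹ with hu
  have hr0 : 0 < r := by positivity
  have hu0 : 0 < u := by positivity
  have hrh : r < 1 / 2 := by
    rw [hr, one_div]; exact inv_strictAnti₀ (by norm_num) hr2
  have hur : u ≤ r * r := by
    rw [hr, hu, ← mul_inv, ← pow_add]
    exact inv_anti₀ (by positivity) (pow_le_pow_right₀ hβ1.le (by omega))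
  have hur' : u < r := by nlinarith
  refine ⟨?_, ?_⟩
  · have anti : StrictAnti fun s : ℝ => r ^ s + u ^ s :=
      (Real.strictAnti_rpow_of_base_lt_one hr0 (by linarith)).add
        (Real.strictAnti_rpow_of_base_lt_one hu0 (by linarith))
    have hc : Continuous fun s : ℝ => r ^ s + u ^ s :=
      (Real.continuous_const_rpow hr0.ne').add (Real.continuous_const_rpow hu0.ne')
    have := intermediate_value_Icc' (zero_le_one (α := ℝ)) hc.continuousOn
    obtain ⟨s, ⟨hs0, hs1⟩, hs⟩ := this (show (1 : ℝ) ∈ _ from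
      ⟨by simp only [Real.rpow_one]; linarith, by simp only [Real.rpow_zero]; norm_num⟩)
    refine ⟨s, ⟨lt_of_le_of_ne hs0 ?_, hs⟩, ?_⟩
    · rintro rfl
      norm_num at hs
    · rintro s' ⟨_, hs'⟩
      exact anti.injective (hs'.trans hs.symm)
  · intro s hs hsum
    set a : Bool → ℝ := fun i => if i then r else u with hadef
    set b : Bool → ℝ := fun _ => 1 / β with hbdef
    have ha0 : ∀ i, 0 < a i := by intro i; cases i <;> simp [hadef, hr0, hu0]
    have ha0' := fun i => (ha0 i).le
    have ha : ∀ i, a i ≤ r := by intro i; cases i <;> simp [hadef, hur'.le]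
    have hρ : r < 1 := by linarith
    have hβi : 0 < 1 / β := by positivity
    have hb : ∀ i, |b i| ≤ 1 / β := fun i => (abs_of_pos hβi).le
    have hrec := code_rec ha0' ha hρ hb
    have hpos0 : ∀ w, 0 ≤ codeMap a b w := fun w =>
      tsum_nonneg fun k => mul_nonneg (Finset.prod_nonneg fun _ _ => ha0' _) hβi.le
    have hlow : ∀ w, 1 / β ≤ codeMap a b w := by
      intro w
      rw [hrec w]
      have := mul_nonneg (ha0' (w 0)) (hpos0 (shiftW w))
      simp only [hbdef] at this ⊢
      linarith
    have hup : ∀ w, codeMap a b w ≤ 2 * (1 / β) := by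
      intro w
      refine (le_abs_self _).trans ((code_abs_le ha0' ha hρ hb w).trans ?_)
      rw [div_le_iff₀ (by linarith)]
      nlinarith
    have hsep1 : ∀ w w' : ℕ → Bool, w 0 = true → w' 0 = false →
        r * (1 - 2 * r) * (1 / β) ≤ codeMap a b w - codeMap a b w' := by
      intro w w' h h'
      rw [hrec w, hrec w', h, h']
      have e1 : r * (1 / β) ≤ r * codeMap a b (shiftW w) :=
        mul_le_mul_of_nonneg_left (hlow _) hr0.le
      have e2 : u * codeMap a b (shiftW w') ≤ (r * r) * (2 * (1 / β)) :=
        mul_le_mul hur (hup _) (hpos0 _) (by positivity)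
      change _ ≤ r * codeMap a b (shiftW w) + 1 / β - (u * codeMap a b (shiftW w') + 1 / β)
      nlinarith
    have hδ : 0 < r * (1 - 2 * r) * (1 / β) :=
      mul_pos (mul_pos hr0 (by linarith)) hβi
    have hsep : ∀ w w' : ℕ → Bool, w 0 ≠ w' 0 →
        r * (1 - 2 * r) * (1 / β) ≤ |codeMap a b w - codeMap a b w'| := by
      intro w w' h
      cases h0 : w 0 <;> cases h1 : w' 0
      · simp [h0, h1] at h
      · rw [abs_sub_comm]
        exact (hsep1 w' w h1 h0).trans (le_abs_self _)
      · exact (hsep1 w w' h0 h1).trans (le_abs_self _)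
      · simp [h0, h1] at h
    have hsum' : a true ^ s + a false ^ s = 1 := by simpa [hadef] using hsum
    refine ⟨range (codeMap a b), range_nonempty _,
      isCompact_range (code_continuous ha0' ha hρ hb), ?_,
      le_antisymm (code_dim_upper ha0 ha hρ hb hs hsum')
        (code_dim_lower ha0 ha hρ hb hs hsum' hδ hsep)⟩
    have g1 : ∀ w, codeMap a b (consW true w) = codeMap a b w / β ^ (n + 2) + 1 / β := by
      intro w
      rw [hrec, shiftW_consW, div_eq_inv_mul]
      rfl
    have g2 : ∀ w, codeMap a b (consW false w) = codeMap a b w / β ^ N + 1 / β := by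
      intro w
      rw [hrec, shiftW_consW, div_eq_inv_mul]
      rfl
    apply Subset.antisymm
    · rintro _ ⟨w, rfl⟩
      have hw := consW_shiftW w
      cases h0 : w 0
      · right
        rw [h0] at hw
        exact ⟨_, ⟨shiftW w, rfl⟩, by simp only [← g2, hw]⟩
      · left
        rw [h0] at hw
        exact ⟨_, ⟨shiftW w, rfl⟩, by simp only [← g1, hw]⟩
    · rintro _ (⟨_, ⟨w, rfl⟩, rfl⟩ | ⟨_, ⟨w, rfl⟩, rfl⟩)
      · exact ⟨_, g1 w⟩
      · exact ⟨_, g2 w⟩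
end
end
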